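/- arXiv:1912.04640 — 12 statements merged into one kernel-verified Lean document; each statement's English description precedes it below -/
import Mathlib

section
/- Let c₁, c₂ ∈ E and r₁, r₂ > 0 with (c₁, r₁) ≠ (c₂, r₂). Let a, b be distinct points of the circle Metric.sphere c₁ r₁ with a ∉ Metric.ball c₂ r₂ and b ∉ Metric.ball c₂ r₂, and let p, q be distinct points of Metric.sphere c₂ r₂ with p ∉ Metric.ball c₁ r₁ and q ∉ Metric.ball c₁ r₁. If the unordered pair {a, b} is different from the unordered pair {p, q}, then openSegment ℝ a b ∩ openSegment ℝ p q = ∅. (Euclidean core of the proposition that any Delaunay triangulation of a closed surface is geometric: two chords, each inscribed in a disk that is empty of the other chord's endpoints, cannot cross in their interiors.) -/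
/-- The difference of the squared distances to two fixed points is an affine function. -/
theorem dist_sq_sub_dist_sq_combo {V : Type*} [NormedAddCommGroup V] [InnerProductSpace ℝ V]
    (a b c d : V) {s t : ℝ} (hst : s + t = 1) :
    dist (s • a + t • b) d ^ 2 - dist (s • a + t • b) c ^ 2 =
      s * (dist a d ^ 2 - dist a c ^ 2) + t * (dist b d ^ 2 - dist b c ^ 2) := by
  simp only [dist_eq_norm, norm_sub_sq_real, inner_add_left, real_inner_smul_left]
  linear_combination (‖c‖ ^ 2 - ‖d‖ ^ 2) * hst

/-- If two chords of two circles, each with endpoints outside the open disk of the other circle,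
cross in their interiors, then all endpoints lie on both circles. -/
theorem dist_eq_of_mem_openSegment_inter {V : Type*} [NormedAddCommGroup V]
    [InnerProductSpace ℝ V] {c₁ c₂ a b p q x : V} {r₁ r₂ : ℝ} (hr₁ : 0 < r₁) (hr₂ : 0 < r₂)
    (ha : dist a c₁ = r₁) (hb : dist b c₁ = r₁) (ha' : r₂ ≤ dist a c₂) (hb' : r₂ ≤ dist b c₂)
    (hp : dist p c₂ = r₂) (hq : dist q c₂ = r₂) (hp' : r₁ ≤ dist p c₁) (hq' : r₁ ≤ dist q c₁)
    (hx : x ∈ openSegment ℝ a b) (hx' : x ∈ openSegment ℝ p q) :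
    dist a c₂ = r₂ ∧ dist b c₂ = r₂ ∧ dist p c₁ = r₁ ∧ dist q c₁ = r₁ := by
  obtain ⟨s, t, hs, ht, hst, rfl⟩ := hx
  obtain ⟨u, v, hu, hv, huv, hx⟩ := hx'
  have h₁ := dist_sq_sub_dist_sq_combo a b c₁ c₂ hst
  have h₂ := dist_sq_sub_dist_sq_combo p q c₁ c₂ huv
  rw [hx, h₁, ha, hb, hp, hq] at h₂
  have sq_le : ∀ {r y : ℝ}, 0 < r → r ≤ y → 0 ≤ y ^ 2 - r ^ 2 := fun hr h => by nlinarith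
  have eq_of_sq : ∀ {r y k : ℝ}, 0 < r → r ≤ y → 0 < k → k * (y ^ 2 - r ^ 2) ≤ 0 → y = r := by
    intro r y k hr h hk hle
    have : y ^ 2 - r ^ 2 ≤ 0 := nonpos_of_mul_nonpos_right hle hk
    nlinarith
  have hka : 0 ≤ s * (dist a c₂ ^ 2 - r₂ ^ 2) := mul_nonneg hs.le (sq_le hr₂ ha')
  have hkb : 0 ≤ t * (dist b c₂ ^ 2 - r₂ ^ 2) := mul_nonneg ht.le (sq_le hr₂ hb')
  have hkp : 0 ≤ u * (dist p c₁ ^ 2 - r₁ ^ 2) := mul_nonneg hu.le (sq_le hr₁ hp')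
  have hkq : 0 ≤ v * (dist q c₁ ^ 2 - r₁ ^ 2) := mul_nonneg hv.le (sq_le hr₁ hq')
  have key : s * (dist a c₂ ^ 2 - r₁ ^ 2) + t * (dist b c₂ ^ 2 - r₁ ^ 2) =
      s * (dist a c₂ ^ 2 - r₂ ^ 2) + t * (dist b c₂ ^ 2 - r₂ ^ 2) + (r₂ ^ 2 - r₁ ^ 2) := by
    linear_combination (r₂ ^ 2 - r₁ ^ 2) * hst
  have key' : u * (r₂ ^ 2 - dist p c₁ ^ 2) + v * (r₂ ^ 2 - dist q c₁ ^ 2) =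
      -(u * (dist p c₁ ^ 2 - r₁ ^ 2)) - v * (dist q c₁ ^ 2 - r₁ ^ 2) + (r₂ ^ 2 - r₁ ^ 2) := by
    linear_combination (r₂ ^ 2 - r₁ ^ 2) * huv
  exact ⟨eq_of_sq hr₂ ha' hs (by linarith), eq_of_sq hr₂ hb' ht (by linarith),
    eq_of_sq hr₁ hp' hu (by linarith), eq_of_sq hr₁ hq' hv (by linarith)⟩

/-- Euclidean core of the proposition that any Delaunay triangulation of a closed
surface is geometric: two chords, each inscribed in a circle bounding a disk that is
empty of the other chord's endpoints, cannot cross in their interiors. -/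
theorem delaunay_chords_disjoint
    (c₁ c₂ : EuclideanSpace ℝ (Fin 2)) (r₁ r₂ : ℝ)
    (hr₁ : 0 < r₁) (hr₂ : 0 < r₂) (hne : (c₁, r₁) ≠ (c₂, r₂))
    (a b : EuclideanSpace ℝ (Fin 2)) (hab : a ≠ b)
    (ha : a ∈ Metric.sphere c₁ r₁) (hb : b ∈ Metric.sphere c₁ r₁)
    (ha' : a ∉ Metric.ball c₂ r₂) (hb' : b ∉ Metric.ball c₂ r₂)
    (p q : EuclideanSpace ℝ (Fin 2)) (hpq : p ≠ q)
    (hp : p ∈ Metric.sphere c₂ r₂) (hq : q ∈ Metric.sphere c₂ r₂)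
    (hp' : p ∉ Metric.ball c₁ r₁) (hq' : q ∉ Metric.ball c₁ r₁)
    (hpairs : ({a, b} : Set (EuclideanSpace ℝ (Fin 2))) ≠ {p, q}) :
    openSegment ℝ a b ∩ openSegment ℝ p q = ∅ := by
  rw [Set.eq_empty_iff_forall_notMem]
  rintro x ⟨hx, hx'⟩
  simp only [Metric.mem_sphere, Metric.mem_ball, not_lt] at ha hb ha' hb' hp hq hp' hq'
  obtain ⟨ha₂, hb₂, hp₁, hq₁⟩ :=
    dist_eq_of_mem_openSegment_inter hr₁ hr₂ ha hb ha' hb' hp hq hp' hq' hx hx'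
  have hc : c₁ ≠ c₂ := by
    rintro rfl
    exact hne (by rw [← ha, ha₂])
  have hfin : Module.finrank ℝ (EuclideanSpace ℝ (Fin 2)) = 2 := finrank_euclideanSpace_fin
  have hp_mem := EuclideanGeometry.eq_of_dist_eq_of_dist_eq_of_finrank_eq_two hfin hc hab
    ha hb hp₁ ha₂ hb₂ hp
  have hq_mem := EuclideanGeometry.eq_of_dist_eq_of_dist_eq_of_finrank_eq_two hfin hc hab
    ha hb hq₁ ha₂ hb₂ hq
  rcases hp_mem with rfl | rfl <;> rcases hq_mem with rfl | rfl
  · exact hpq rfl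
  · exact hpairs rfl
  · exact hpairs (Set.pair_comm _ _)
  · exact hpq rfl
end

section
/- Let c₁, c₂ ∈ E and r₁, r₂ > 0 with (c₁, r₁) ≠ (c₂, r₂), and suppose the circles Metric.sphere c₁ r₁ and Metric.sphere c₂ r₂ intersect in two distinct points x and y. Then for every p ∈ Metric.sphere c₁ r₁ with p ∉ Metric.ball c₂ r₂ and every q ∈ Metric.sphere c₂ r₂ with q ∉ Metric.ball c₁ r₁, the points p and q lie weakly on opposite sides of the radical line through x and y, i.e. (affineSpan ℝ {x, y}).WOppSide p q. -/
open scoped RealInnerProductSpace in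
/-- The difference of the powers of a point `z` with respect to two circles through `x`. -/
lemma dist_sq_sub_dist_sq_eq_inner {V : Type*} [NormedAddCommGroup V] [InnerProductSpace ℝ V]
    {c₁ c₂ x : V} {r₁ r₂ : ℝ} (hx₁ : dist x c₁ = r₁) (hx₂ : dist x c₂ = r₂) (z : V) :
    (dist z c₂ ^ 2 - r₂ ^ 2) - (dist z c₁ ^ 2 - r₁ ^ 2) = 2 * ⟪z - x, c₁ - c₂⟫ := by
  subst hx₁ hx₂
  simp only [dist_eq_norm, norm_sub_sq_real, inner_sub_left, inner_sub_right]
  ring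

open scoped RealInnerProductSpace in
/-- In a Euclidean plane, if `m` is a nonzero normal vector of the line through `x` and `y`,
then points at which `⟪· - x, m⟫` has opposite signs lie weakly on opposite sides of the line. -/
lemma wOppSide_affineSpan_pair_of_inner {V : Type*} [NormedAddCommGroup V]
    [InnerProductSpace ℝ V] [Fact (Module.finrank ℝ V = 2)] {x y m p q : V}
    (hxy : x ≠ y) (hm : m ≠ 0) (hym : ⟪y - x, m⟫ = 0)
    (hp : 0 ≤ ⟪p - x, m⟫) (hq : ⟪q - x, m⟫ ≤ 0) :
    (affineSpan ℝ ({x, y} : Set V)).WOppSide p q := by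
  have hmm : ⟪m, m⟫ ≠ 0 := inner_self_ne_zero.mpr hm
  have foot_mem (z : V) :
      z - (⟪z - x, m⟫ / ⟪m, m⟫) • m ∈ affineSpan ℝ ({x, y} : Set V) := by
    obtain ⟨t, ht⟩ := Submodule.mem_span_singleton.mp <|
      Submodule.mem_span_singleton_of_inner_eq_zero_of_inner_eq_zero (𝕜 := ℝ)
        (u := z - x - (⟪z - x, m⟫ / ⟪m, m⟫) • m) hm (sub_ne_zero.mpr hxy.symm)
        (by rw [inner_sub_right, real_inner_smul_right, div_mul_cancel₀ _ hmm,
          real_inner_comm, sub_self])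
        (by rwa [real_inner_comm])
    have h := AffineMap.lineMap_mem_affineSpan_pair t x y
    rwa [AffineMap.lineMap_apply_module', ht, sub_right_comm, sub_add_cancel] at h
  refine AffineSubspace.wOppSide_of_vsub_eq_smul (foot_mem p) (foot_mem q) (m := m)
    (c₁ := ⟪p - x, m⟫ / ⟪m, m⟫) (c₂ := ⟪q - x, m⟫ / ⟪m, m⟫) (by simp) (by simp) ?_
  exact mul_nonpos_of_nonneg_of_nonpos (div_nonneg hp real_inner_self_nonneg)
    (div_nonpos_of_nonpos_of_nonneg hq real_inner_self_nonneg)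

/-- If two distinct circles intersect in two points `x`, `y`, then any point of the
first circle outside the open disk of the second and any point of the second circle
outside the open disk of the first lie weakly on opposite sides of the line through
`x` and `y`. -/
theorem opposite_sides_of_radical_line
    (c₁ c₂ : EuclideanSpace ℝ (Fin 2)) (r₁ r₂ : ℝ)
    (hr₁ : 0 < r₁) (hr₂ : 0 < r₂) (hne : (c₁, r₁) ≠ (c₂, r₂))
    (x y : EuclideanSpace ℝ (Fin 2)) (hxy : x ≠ y)
    (hx₁ : x ∈ Metric.sphere c₁ r₁) (hx₂ : x ∈ Metric.sphere c₂ r₂)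
    (hy₁ : y ∈ Metric.sphere c₁ r₁) (hy₂ : y ∈ Metric.sphere c₂ r₂) :
    ∀ p ∈ Metric.sphere c₁ r₁, p ∉ Metric.ball c₂ r₂ →
    ∀ q ∈ Metric.sphere c₂ r₂, q ∉ Metric.ball c₁ r₁ →
      (affineSpan ℝ ({x, y} : Set (EuclideanSpace ℝ (Fin 2)))).WOppSide p q := by
  intro p hp hp' q hq hq'
  rw [Metric.mem_sphere] at hx₁ hx₂ hy₁ hy₂ hp hq
  rw [Metric.mem_ball, not_lt] at hp' hq'
  have hm : c₁ - c₂ ≠ 0 := by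
    rw [sub_ne_zero]
    rintro rfl
    exact hne (by rw [← hx₁, ← hx₂])
  have key := dist_sq_sub_dist_sq_eq_inner hx₁ hx₂
  have : Fact (Module.finrank ℝ (EuclideanSpace ℝ (Fin 2)) = 2) := ⟨finrank_euclideanSpace_fin⟩
  refine wOppSide_affineSpan_pair_of_inner hxy hm ?_ ?_ ?_
  · have := key y
    rw [hy₁, hy₂] at this
    linarith
  · have := key p
    rw [hp] at this
    nlinarith
  · have := key q
    rw [hq] at this
    nlinarith
end

section
/- Let v₁, v₂, v₃, v₄ ∈ E with v₁ ≠ v₂, and suppose v₃ and v₄ lie strictly on opposite sides of the line through v₁ and v₂. Let (c, r) be a circumcenter–circumradius pair for v₁, v₂, v₃ and assume dist c v₄ < r (the edge v₁v₂ is Delaunay flippable). Then the open segments openSegment ℝ v₁ v₂ and openSegment ℝ v₃ v₄ intersect, i.e. (openSegment ℝ v₁ v₂ ∩ openSegment ℝ v₃ v₄).Nonempty. (Euclidean core of the lemma that a Delaunay flip transforms a geometric triangulation into a geometric triangulation: the quadrilateral formed by the two triangles is strictly convex, so the new diagonal crosses the old one.) -/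
theorem Sbtw.mem_openSegment {E : Type*} [AddCommGroup E] [Module ℝ E] {x y z : E}
    (h : Sbtw ℝ x y z) : y ∈ openSegment ℝ x z := by
  rw [openSegment_eq_image_lineMap]
  exact h.mem_image_Ioo


/-- Euclidean core of the lemma that a Delaunay flip transforms a geometric
triangulation into a geometric triangulation: if the edge `v₁v₂` is Delaunay
flippable, the quadrilateral is strictly convex, so the new diagonal `v₃v₄`
crosses the old one. -/
theorem delaunay_flip_diagonals_cross
    (v₁ v₂ v₃ v₄ : EuclideanSpace ℝ (Fin 2)) (h12 : v₁ ≠ v₂)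
    (hopp : (affineSpan ℝ ({v₁, v₂} : Set (EuclideanSpace ℝ (Fin 2)))).SOppSide v₃ v₄)
    (c : EuclideanSpace ℝ (Fin 2)) (r : ℝ)
    (hc₁ : dist c v₁ = r) (hc₂ : dist c v₂ = r) (hc₃ : dist c v₃ = r)
    (hflip : dist c v₄ < r) :
    (openSegment ℝ v₁ v₂ ∩ openSegment ℝ v₃ v₄).Nonempty := by
  obtain ⟨p, hp, hsbtw⟩ := hopp.exists_sbtw
  have hlt : dist p c < r := by
    refine (hsbtw.dist_lt_max_dist c).trans_le ?_
    rw [dist_comm v₃, dist_comm v₄, hc₃]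
    exact max_le le_rfl hflip.le
  have hcol : Collinear ℝ {v₁, p, v₂} := by
    rw [Set.insert_comm]
    exact collinear_insert_of_mem_affineSpan_pair hp
  refine ⟨p, Sbtw.mem_openSegment ?_, hsbtw.mem_openSegment⟩
  exact hcol.sbtw_of_dist_eq_of_dist_lt (p := c) (r := r)
    (by rwa [dist_comm]) hlt (by rwa [dist_comm]) h12
end

section
/- Let v₁, v₂, v₃, v₄ ∈ E with v₁ ≠ v₂, and suppose v₃ and v₄ lie strictly on opposite sides of the line through v₁ and v₂. Let (c, r) be a circumcenter–circumradius pair for v₁, v₂, v₃ and assume dist c v₄ < r. Then the sum of the angles of the two triangles at each shared vertex is strictly less than π: ∠ v₃ v₁ v₂ + ∠ v₂ v₁ v₄ < π and ∠ v₃ v₂ v₁ + ∠ v₁ v₂ v₄ < π, where ∠ a b c denotes the (unsigned) Euclidean angle at b. (The strict convexity of the quadrilateral at the endpoints of a Delaunay flippable edge.) -/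
open EuclideanGeometry

section

variable {V P : Type*} [NormedAddCommGroup V] [InnerProductSpace ℝ V] [MetricSpace P]
  [NormedAddTorsor V P]

/-- If the segments `p q` and `a b` cross at an interior point of both, and `p` is not on the line
through `a` and `b`, then the angles at `a` on both sides of `a b` add up to less than `π`. -/
theorem angle_add_angle_lt_pi_of_sbtw_of_sbtw {a b p q x : P} (hp : p ∉ line[ℝ, a, b])
    (hpq : Sbtw ℝ p x q) (hab : Sbtw ℝ a x b) : ∠ p a b + ∠ b a q < Real.pi := by
  rw [← hab.angle_eq_right p, angle_comm b a q, ← hab.angle_eq_right q, angle_comm q a x,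
    angle_add_angle_eq_of_sbtw hpq]
  refine (angle_le_pi p a q).lt_of_ne fun h => hp ?_
  have ha := angle_eq_pi_iff_sbtw.1 h
  have hcol : Collinear ℝ ({a, x, p} : Set P) :=
    collinear_triple_of_mem_affineSpan_pair ha.wbtw.mem_affineSpan hpq.wbtw.mem_affineSpan
      (left_mem_affineSpan_pair ℝ p q)
  exact affineSpan_pair_le_of_right_mem hab.wbtw.mem_affineSpan
    (hcol.mem_affineSpan_of_mem_of_ne (by simp) (by simp) (by simp) hab.left_ne)

end

/-- Strict convexity of the quadrilateral at the endpoints of a Delaunay flippable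
edge: the sum of the angles of the two triangles at each shared vertex is
strictly less than `π`. -/
theorem delaunay_flip_quadrilateral_strictly_convex
    (v₁ v₂ v₃ v₄ : EuclideanSpace ℝ (Fin 2)) (h12 : v₁ ≠ v₂)
    (hopp : (affineSpan ℝ ({v₁, v₂} : Set (EuclideanSpace ℝ (Fin 2)))).SOppSide v₃ v₄)
    (c : EuclideanSpace ℝ (Fin 2)) (r : ℝ)
    (hc₁ : dist c v₁ = r) (hc₂ : dist c v₂ = r) (hc₃ : dist c v₃ = r)
    (hflip : dist c v₄ < r) :
    ∠ v₃ v₁ v₂ + ∠ v₂ v₁ v₄ < Real.pi ∧ ∠ v₃ v₂ v₁ + ∠ v₁ v₂ v₄ < Real.pi := by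
  obtain ⟨x, hx, h34⟩ := hopp.exists_sbtw
  have hdist : dist x c < r := by
    have h := h34.dist_lt_max_dist c
    rwa [dist_comm v₃, dist_comm v₄, hc₃, max_eq_left hflip.le] at h
  have hcol : Collinear ℝ ({v₁, x, v₂} : Set (EuclideanSpace ℝ (Fin 2))) :=
    collinear_triple_of_mem_affineSpan_pair (left_mem_affineSpan_pair ℝ v₁ v₂) hx
      (right_mem_affineSpan_pair ℝ v₁ v₂)
  have h12x : Sbtw ℝ v₁ x v₂ :=
    hcol.sbtw_of_dist_eq_of_dist_lt (by rwa [dist_comm]) hdist (by rwa [dist_comm]) h12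
  refine ⟨angle_add_angle_lt_pi_of_sbtw_of_sbtw hopp.left_notMem h34 h12x,
    angle_add_angle_lt_pi_of_sbtw_of_sbtw ?_ h34 h12x.symm⟩
  rw [Set.pair_comm]
  exact hopp.left_notMem
end

section
/- Let v₁, v₂, v₃, v₄ ∈ E with v₁ ≠ v₂, and suppose v₃ and v₄ lie strictly on opposite sides of the line through v₁ and v₂. Let (c₁, r₁) be a circumcenter–circumradius pair for v₁, v₂, v₃ and (c₂, r₂) a circumcenter–circumradius pair for v₁, v₂, v₄. Then dist c₁ v₄ < r₁ if and only if dist c₂ v₃ < r₂: v₄ lies strictly inside the circumdisk of v₁v₂v₃ if and only if v₃ lies strictly inside the circumdisk of v₁v₂v₄. -/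
/-- Stewart's theorem, for the point dividing a segment in the ratio `t : 1 - t`. -/
theorem dist_sq_lineMap {V P : Type*} [NormedAddCommGroup V] [InnerProductSpace ℝ V]
    [MetricSpace P] [NormedAddTorsor V P] (c x y : P) (t : ℝ) :
    dist c (AffineMap.lineMap x y t) ^ 2 =
      (1 - t) * dist c x ^ 2 + t * dist c y ^ 2 - t * (1 - t) * dist x y ^ 2 := by
  have hp : (AffineMap.lineMap x y t : P) -ᵥ c = (1 - t) • (x -ᵥ c) + t • (y -ᵥ c) := by
    rw [AffineMap.lineMap_apply, vadd_vsub_assoc, ← vsub_sub_vsub_cancel_right y x c]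
    module
  rw [dist_comm c, dist_comm c, dist_comm c, dist_eq_norm_vsub V _ c, dist_eq_norm_vsub V x c,
    dist_eq_norm_vsub V y c, dist_eq_norm_vsub V x y, hp, ← vsub_sub_vsub_cancel_right x y c,
    norm_add_sq_real, norm_sub_sq_real, norm_smul, norm_smul, mul_pow, mul_pow,
    Real.norm_eq_abs, Real.norm_eq_abs, sq_abs, sq_abs, real_inner_smul_left,
    real_inner_smul_right]
  ring

/-- `v₄` lies strictly inside the circumdisk of `v₁v₂v₃` if and only if `v₃` lies
strictly inside the circumdisk of `v₁v₂v₄`. -/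
theorem inCircle_symm
    (v₁ v₂ v₃ v₄ : EuclideanSpace ℝ (Fin 2)) (h12 : v₁ ≠ v₂)
    (hopp : (affineSpan ℝ ({v₁, v₂} : Set (EuclideanSpace ℝ (Fin 2)))).SOppSide v₃ v₄)
    (c₁ : EuclideanSpace ℝ (Fin 2)) (r₁ : ℝ)
    (hc₁₁ : dist c₁ v₁ = r₁) (hc₁₂ : dist c₁ v₂ = r₁) (hc₁₃ : dist c₁ v₃ = r₁)
    (c₂ : EuclideanSpace ℝ (Fin 2)) (r₂ : ℝ)
    (hc₂₁ : dist c₂ v₁ = r₂) (hc₂₂ : dist c₂ v₂ = r₂) (hc₂₄ : dist c₂ v₄ = r₂) :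
    dist c₁ v₄ < r₁ ↔ dist c₂ v₃ < r₂ := by
  obtain ⟨p, hp, hsbtw⟩ := hopp.exists_sbtw
  obtain ⟨s, rfl⟩ := mem_affineSpan_pair_iff_exists_lineMap_eq.1 hp
  obtain ⟨t, ⟨ht0, ht1⟩, ht⟩ := (sbtw_iff_mem_image_Ioo_and_ne.1 hsbtw).1
  have key : t * (r₁ ^ 2 - dist c₁ v₄ ^ 2) = (1 - t) * (r₂ ^ 2 - dist c₂ v₃ ^ 2) := by
    have h₁ := dist_sq_lineMap c₁ v₁ v₂ s
    have h₂ := dist_sq_lineMap c₂ v₁ v₂ s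
    rw [← ht, dist_sq_lineMap c₁ v₃ v₄ t, hc₁₁, hc₁₂, hc₁₃] at h₁
    rw [← ht, dist_sq_lineMap c₂ v₃ v₄ t, hc₂₁, hc₂₂, hc₂₄] at h₂
    linarith
  have hr₁ : 0 ≤ r₁ := hc₁₁ ▸ dist_nonneg
  have hr₂ : 0 ≤ r₂ := hc₂₁ ▸ dist_nonneg
  rw [← sq_lt_sq₀ dist_nonneg hr₁, ← sq_lt_sq₀ dist_nonneg hr₂, ← sub_pos,
    ← mul_pos_iff_of_pos_left ht0, key, mul_pos_iff_of_pos_left (sub_pos.2 ht1), sub_pos]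
end

section
/- Let v₁, v₂, v₃, v₄ ∈ E with v₁ ≠ v₂ and v₃ ≠ v₄, suppose v₃ and v₄ lie strictly on opposite sides of the line through v₁ and v₂, and v₁ and v₂ lie strictly on opposite sides of the line through v₃ and v₄. Let (c, r) be a circumcenter–circumradius pair for v₁, v₂, v₃ and (c', r') a circumcenter–circumradius pair for v₂, v₃, v₄. Then dist c v₄ < r if and only if r' < dist c' v₁: the edge v₁v₂ is Delaunay flippable if and only if after the flip the circumdisk of the new triangle v₂v₃v₄ does not contain v₁, i.e. the triangulation of the quadrilateral is locally Delaunay after the flip. -/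
/-- Stewart's theorem for a point of the line through `a` and `b`. -/
theorem dist_sq_lineMap_eq {V : Type*} [NormedAddCommGroup V] [InnerProductSpace ℝ V]
    (c a b : V) (t : ℝ) :
    dist c (AffineMap.lineMap a b t) ^ 2 =
      (1 - t) * dist c a ^ 2 + t * dist c b ^ 2 - t * (1 - t) * dist a b ^ 2 := by
  have h : c - AffineMap.lineMap a b t = (1 - t) • (c - a) + t • (c - b) := by
    rw [AffineMap.lineMap_apply_module]
    module
  have h' : a - b = (c - b) - (c - a) := by abel
  rw [dist_eq_norm, dist_eq_norm, dist_eq_norm, dist_eq_norm, h, h', norm_add_sq_real,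
    norm_sub_sq_real (c - b), norm_smul, norm_smul, mul_pow, mul_pow, Real.norm_eq_abs,
    Real.norm_eq_abs, sq_abs, sq_abs, real_inner_smul_left, real_inner_smul_right,
    real_inner_comm (c - a) (c - b)]
  ring

/-- A line meets another line not containing one of its two spanning points in at most one point. -/
theorem eq_of_mem_affineSpan_pair_of_notMem {V : Type*} [AddCommGroup V] [Module ℝ V]
    {a b x y p q : V} (hpab : p ∈ affineSpan ℝ {a, b}) (hqab : q ∈ affineSpan ℝ {a, b})
    (hpxy : p ∈ affineSpan ℝ {x, y}) (hqxy : q ∈ affineSpan ℝ {x, y})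
    (hx : x ∉ affineSpan ℝ {a, b}) : p = q := by
  by_contra hpq
  obtain ⟨s, rfl⟩ := mem_affineSpan_pair_iff_exists_lineMap_eq.1 hpxy
  obtain ⟨t, rfl⟩ := mem_affineSpan_pair_iff_exists_lineMap_eq.1 hqxy
  have hst : s - t ≠ 0 := sub_ne_zero.2 fun h => hpq (by rw [h])
  refine hx ?_
  convert AffineMap.lineMap_mem (s / (s - t)) hpab hqab using 1
  rw [AffineMap.lineMap_apply_module, AffineMap.lineMap_apply_module,
    AffineMap.lineMap_apply_module]
  match_scalars <;> field_simp <;> ring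

/-- The edge `v₁v₂` is Delaunay flippable if and only if after the flip the
circumdisk of the new triangle `v₂v₃v₄` does not contain `v₁`: the triangulation
of the quadrilateral is locally Delaunay after the flip. -/
theorem delaunay_flip_locally_delaunay
    (v₁ v₂ v₃ v₄ : EuclideanSpace ℝ (Fin 2)) (h12 : v₁ ≠ v₂) (h34 : v₃ ≠ v₄)
    (hopp : (affineSpan ℝ ({v₁, v₂} : Set (EuclideanSpace ℝ (Fin 2)))).SOppSide v₃ v₄)
    (hopp' : (affineSpan ℝ ({v₃, v₄} : Set (EuclideanSpace ℝ (Fin 2)))).SOppSide v₁ v₂)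
    (c : EuclideanSpace ℝ (Fin 2)) (r : ℝ)
    (hc₁ : dist c v₁ = r) (hc₂ : dist c v₂ = r) (hc₃ : dist c v₃ = r)
    (c' : EuclideanSpace ℝ (Fin 2)) (r' : ℝ)
    (hc'₂ : dist c' v₂ = r') (hc'₃ : dist c' v₃ = r') (hc'₄ : dist c' v₄ = r') :
    dist c v₄ < r ↔ r' < dist c' v₁ := by
  obtain ⟨p, hp, hp34⟩ := hopp.exists_sbtw
  obtain ⟨q, hq, hq12⟩ := hopp'.exists_sbtw
  obtain rfl : p = q := eq_of_mem_affineSpan_pair_of_notMem hp hq12.wbtw.mem_affineSpan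
    hp34.wbtw.mem_affineSpan hq hopp.2.1
  obtain ⟨t, ht, hpt⟩ := hp34.mem_image_Ioo
  obtain ⟨s, hs, hps⟩ := hq12.mem_image_Ioo
  have e₁ := dist_sq_lineMap_eq c v₁ v₂ s
  have e₂ := dist_sq_lineMap_eq c' v₁ v₂ s
  have e₃ := dist_sq_lineMap_eq c v₃ v₄ t
  have e₄ := dist_sq_lineMap_eq c' v₃ v₄ t
  rw [hps, hc₁, hc₂] at e₁
  rw [hps, hc'₂] at e₂
  rw [hpt, hc₃] at e₃
  rw [hpt, hc'₃, hc'₄] at e₄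
  have key : t * (r ^ 2 - dist c v₄ ^ 2) = (1 - s) * (dist c' v₁ ^ 2 - r' ^ 2) := by
    linear_combination e₂ - e₁ + e₃ - e₄
  rw [← sq_lt_sq₀ dist_nonneg (hc₁ ▸ dist_nonneg), ← sq_lt_sq₀ (hc'₂ ▸ dist_nonneg) dist_nonneg,
    ← sub_pos, ← mul_pos_iff_of_pos_left ht.1, key, mul_pos_iff_of_pos_left (sub_pos.2 hs.2),
    sub_pos]
end

section
/- Let v₁, v₂, v₃, v₄ ∈ E with v₁ ≠ v₂ and v₃ ≠ v₄, suppose v₃ and v₄ lie strictly on opposite sides of the line through v₁ and v₂, and v₁ and v₂ lie strictly on opposite sides of the line through v₃ and v₄. Let (c₁, r₁), (c₂, r₂), (c'₁, r'₁), (c'₂, r'₂) be circumcenter–circumradius pairs for the triples (v₁, v₂, v₃), (v₁, v₂, v₄), (v₃, v₄, v₁), (v₃, v₄, v₂) respectively, and assume dist c₁ v₄ < r₁ (the flip of the diagonal v₁v₂ is Delaunay). Then the union of the open circumdisks after the flip is contained in the union before the flip: Metric.ball c'₁ r'₁ ∪ Metric.ball c'₂ r'₂ ⊆ Metric.ball c₁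 r₁ ∪ Metric.ball c₂ r₂. -/
section

variable {V : Type*} [NormedAddCommGroup V] [InnerProductSpace ℝ V]

/-- The difference of the powers of a point with respect to two circles is an affine function. -/
lemma dist_sq_sub_dist_sq_affine_combination (c d u v w : V) (a b : ℝ) :
    dist c (u + a • (v - u) + b • (w - u)) ^ 2 - dist d (u + a • (v - u) + b • (w - u)) ^ 2 =
      (1 - a - b) * (dist c u ^ 2 - dist d u ^ 2) + a * (dist c v ^ 2 - dist d v ^ 2) +
        b * (dist c w ^ 2 - dist d w ^ 2) := by
  have key (x : V) : dist c x ^ 2 - dist d x ^ 2 = 2 * inner ℝ (d - c) x + (‖c‖ ^ 2 - ‖d‖ ^ 2) := by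
    rw [dist_eq_norm, dist_eq_norm, norm_sub_sq_real, norm_sub_sq_real, inner_sub_left]
    ring
  simp only [key, inner_add_right, inner_sub_right, inner_smul_right]
  ring

/-- A point in the cone opposite at `u` to the triangle `u v w` is not inside the circumcircle. -/
lemma circumradius_le_dist_of_nonpos {c u v w : V} {r a b : ℝ} (hu : dist c u = r)
    (hv : dist c v = r) (hw : dist c w = r) (ha : a ≤ 0) (hb : b ≤ 0) :
    r ≤ dist c (u + a • (v - u) + b • (w - u)) := by
  have h : (1 - a - b) • (c - u) =
      (c - (u + a • (v - u) + b • (w - u))) + (-a) • (c - v) + (-b) • (c - w) := by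
    module
  have h' := congrArg norm h
  rw [norm_smul, Real.norm_of_nonneg (by linarith), ← dist_eq_norm, hu] at h'
  have h₃ := norm_add₃_le (a := c - (u + a • (v - u) + b • (w - u))) (b := (-a) • (c - v))
    (c := (-b) • (c - w))
  rw [norm_smul, norm_smul, Real.norm_of_nonneg (neg_nonneg.2 ha),
    Real.norm_of_nonneg (neg_nonneg.2 hb), ← dist_eq_norm, ← dist_eq_norm, ← dist_eq_norm, hv,
    hw] at h₃
  linarith

/-- If the segment from `v` to `w` crosses the line through `y` and `z`, and `w` is inside a circle
through `y`, `z`, `v`, then `v` is inside any circle through `y`, `z`, `w`. -/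
lemma dist_lt_of_sOppSide_of_dist_lt {y z v w c d : V} {r s : ℝ}
    (hopp : (affineSpan ℝ ({y, z} : Set V)).SOppSide v w)
    (hcy : dist c y = r) (hcz : dist c z = r) (hcv : dist c v = r)
    (hdy : dist d y = s) (hdz : dist d z = s) (hdw : dist d w = s)
    (h : dist c w < r) : dist d v < s := by
  obtain ⟨p, hp, ⟨t, ⟨ht0, ht1⟩, rfl⟩, hpv, hpw⟩ := hopp.exists_sbtw
  obtain ⟨m, hm⟩ := mem_affineSpan_pair_iff_exists_lineMap_eq.1 hp
  have ht0' : 0 < t := ht0.lt_of_ne (by rintro rfl; simp at hpv)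
  have ht1' : t < 1 := ht1.lt_of_ne (by rintro rfl; simp at hpw)
  have e₁ := dist_sq_sub_dist_sq_affine_combination c d y z z m 0
  have e₂ := dist_sq_sub_dist_sq_affine_combination c d v w w t 0
  have hm' : y + m • (z - y) = v + t • (w - v) := by
    simpa [AffineMap.lineMap_apply, add_comm] using hm
  simp only [zero_smul, add_zero] at e₁ e₂
  rw [hm', e₂, hcy, hcz, hdy, hdz, hcv, hdw] at e₁
  have hr : dist c w ^ 2 < r ^ 2 := by gcongr
  have h₅ : 0 < s ^ 2 - dist d v ^ 2 := by
    refine pos_of_mul_pos_right (a := 1 - t) ?_ (by linarith)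
    nlinarith
  exact lt_of_pow_lt_pow_left₀ 2 (hdy ▸ dist_nonneg) (by linarith)

end

/-- In the plane, a point off the line through `v` and `w` forms an affine frame with them. -/
lemma exists_eq_add_smul_sub_add_smul_sub {u v w : EuclideanSpace ℝ (Fin 2)} (hvw : v ≠ w)
    (hu : u ∉ affineSpan ℝ ({v, w} : Set (EuclideanSpace ℝ (Fin 2))))
    (x : EuclideanSpace ℝ (Fin 2)) : ∃ a b : ℝ, x = u + a • (v - u) + b • (w - u) := by
  have hli : AffineIndependent ℝ ![u, v, w] :=
    affineIndependent_of_ne_of_notMem_of_mem_of_mem hvw hu (left_mem_affineSpan_pair ℝ v w)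
      (right_mem_affineSpan_pair ℝ v w)
  have htop : affineSpan ℝ (Set.range ![u, v, w]) = ⊤ := by
    rw [hli.affineSpan_eq_top_iff_card_eq_finrank_add_one]
    simp
  obtain ⟨f, hf, hx⟩ := eq_affineCombination_of_mem_affineSpan_of_fintype
    (htop ▸ AffineSubspace.mem_top ℝ _ x)
  rw [Finset.univ.affineCombination_eq_linear_combination _ _ hf] at hx
  rw [Fin.sum_univ_three] at hf hx
  refine ⟨f 1, f 2, ?_⟩
  have hf' : f 0 = 1 - f 1 - f 2 := by linarith
  simp only [hf', Matrix.cons_val] at hx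
  rw [hx]
  module

/-- The circumdisk of `u v w` is covered by any disks through `u`, `v` and `u`, `w` that contain
`w` and `v` respectively. -/
lemma ball_subset_union_ball {u v w c d e : EuclideanSpace ℝ (Fin 2)} {r s q : ℝ} (hvw : v ≠ w)
    (hu : u ∉ affineSpan ℝ ({v, w} : Set (EuclideanSpace ℝ (Fin 2))))
    (hcu : dist c u = r) (hcv : dist c v = r) (hcw : dist c w < r)
    (hdu : dist d u = s) (hdw : dist d w = s) (hdv : dist d v < s)
    (heu : dist e u = q) (hev : dist e v = q) (hew : dist e w = q) :
    Metric.ball e q ⊆ Metric.ball c r ∪ Metric.ball d s := by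
  intro x hx
  by_contra hx'
  simp only [Set.mem_union, Metric.mem_ball, not_or, not_lt, dist_comm x] at hx hx'
  obtain ⟨hxc, hxd⟩ := hx'
  obtain ⟨a, b, rfl⟩ := exists_eq_add_smul_sub_add_smul_sub hvw hu x
  refine hx.not_ge (circumradius_le_dist_of_nonpos heu hev hew ?_ ?_)
  · have key := dist_sq_sub_dist_sq_affine_combination e d u v w a b
    rw [heu, hev, hew, hdu, hdw] at key
    have h₁ := pow_lt_pow_left₀ hx dist_nonneg two_ne_zero
    have h₂ := pow_le_pow_left₀ (hdu ▸ dist_nonneg) hxd 2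
    have h₃ := pow_lt_pow_left₀ hdv dist_nonneg two_ne_zero
    nlinarith
  · have key := dist_sq_sub_dist_sq_affine_combination e c u v w a b
    rw [heu, hev, hew, hcu, hcv] at key
    have h₁ := pow_lt_pow_left₀ hx dist_nonneg two_ne_zero
    have h₂ := pow_le_pow_left₀ (hcu ▸ dist_nonneg) hxc 2
    have h₃ := pow_lt_pow_left₀ hcw dist_nonneg two_ne_zero
    nlinarith


/-- After a Delaunay flip, the union of the open circumdisks is contained in the
union of the open circumdisks before the flip. -/
theorem delaunay_flip_union_circumdisks_subset
    (v₁ v₂ v₃ v₄ : EuclideanSpace ℝ (Fin 2)) (h12 : v₁ ≠ v₂) (h34 : v₃ ≠ v₄)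
    (hopp : (affineSpan ℝ ({v₁, v₂} : Set (EuclideanSpace ℝ (Fin 2)))).SOppSide v₃ v₄)
    (hopp' : (affineSpan ℝ ({v₃, v₄} : Set (EuclideanSpace ℝ (Fin 2)))).SOppSide v₁ v₂)
    (c₁ : EuclideanSpace ℝ (Fin 2)) (r₁ : ℝ)
    (hc₁₁ : dist c₁ v₁ = r₁) (hc₁₂ : dist c₁ v₂ = r₁) (hc₁₃ : dist c₁ v₃ = r₁)
    (c₂ : EuclideanSpace ℝ (Fin 2)) (r₂ : ℝ)
    (hc₂₁ : dist c₂ v₁ = r₂) (hc₂₂ : dist c₂ v₂ = r₂) (hc₂₄ : dist c₂ v₄ = r₂)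
    (c'₁ : EuclideanSpace ℝ (Fin 2)) (r'₁ : ℝ)
    (hc'₁₃ : dist c'₁ v₃ = r'₁) (hc'₁₄ : dist c'₁ v₄ = r'₁) (hc'₁₁ : dist c'₁ v₁ = r'₁)
    (c'₂ : EuclideanSpace ℝ (Fin 2)) (r'₂ : ℝ)
    (hc'₂₃ : dist c'₂ v₃ = r'₂) (hc'₂₄ : dist c'₂ v₄ = r'₂) (hc'₂₂ : dist c'₂ v₂ = r'₂)
    (hflip : dist c₁ v₄ < r₁) :
    Metric.ball c'₁ r'₁ ∪ Metric.ball c'₂ r'₂ ⊆ Metric.ball c₁ r₁ ∪ Metric.ball c₂ r₂ := by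
  have h := dist_lt_of_sOppSide_of_dist_lt hopp hc₁₁ hc₁₂ hc₁₃ hc₂₁ hc₂₂ hc₂₄ hflip
  exact Set.union_subset
    (ball_subset_union_ball h34 hopp'.left_notMem hc₁₁ hc₁₃ hflip hc₂₁ hc₂₄ h hc'₁₁ hc'₁₃ hc'₁₄)
    (ball_subset_union_ball h34 hopp'.right_notMem hc₁₂ hc₁₃ hflip hc₂₂ hc₂₄ h hc'₂₂ hc'₂₃ hc'₂₄)
end

section
/- Let v₁, v₂, v₃, v₄ ∈ E with v₁ ≠ v₂ and v₃ ≠ v₄, suppose v₃ and v₄ lie strictly on opposite sides of the line through v₁ and v₂, and v₁ and v₂ lie strictly on opposite sides of the line through v₃ and v₄. Let (c₁, r₁), (c₂, r₂), (c'₁, r'₁), (c'₂, r'₂) be circumcenter–circumradius pairs for the triples (v₁, v₂, v₃), (v₁, v₂, v₄), (v₃, v₄, v₁), (v₃, v₄, v₂) respectively, and assume dist c₁ v₄ < r₁ (the flip of the diagonal v₁v₂ is Delaunay). Then the intersection of the open circumdisks after the flip is contained in the intersection before the flip: Metric.ball c'₁ r'₁ ∩ Metric.ball c'₂ r'₂ ⊆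 Metric.ball c₁ r₁ ∩ Metric.ball c₂ r₂. -/
open scoped RealInnerProductSpace

section InnerProductSpace

variable {V : Type*} [NormedAddCommGroup V] [InnerProductSpace ℝ V]

/-- The squared distance from `c` to `o + x • a + y • b`, expanded in the oblique coordinates
`x`, `y`. -/
lemma dist_add_smul_add_smul_sq (c o a b : V) (x y : ℝ) :
    dist c (o + x • a + y • b) ^ 2 =
      ‖a‖ ^ 2 * x ^ 2 + 2 * ⟪a, b⟫ * x * y + ‖b‖ ^ 2 * y ^ 2
        - 2 * x * ⟪c - o, a⟫ - 2 * y * ⟪c - o, b⟫ + ‖c - o‖ ^ 2 := by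
  have h : c - (o + x • a + y • b) = (c - o) - (x • a + y • b) := by abel
  rw [dist_eq_norm, h, norm_sub_sq_real, norm_add_sq_real]
  simp only [inner_add_right, inner_smul_left, inner_smul_right, norm_smul, mul_pow,
    Real.norm_eq_abs, sq_abs, RCLike.conj_to_real]
  ring

/-- If the sphere through `o - s • a`, `o + t • a`, `o + m • b` strictly encloses `o - n • b`, then
the product of the distances from `o` to the two points on the line in direction `b` is smaller than
the product of the distances to the two points on the line in direction `a`. -/
lemma mul_norm_sq_lt_of_dist_lt {o a b c : V} {r s t m n : ℝ}
    (hs : 0 < s) (ht : 0 < t) (hm : 0 < m) (hn : 0 < n)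
    (h₁ : dist c (o + (-s) • a) = r) (h₂ : dist c (o + t • a) = r)
    (h₃ : dist c (o + m • b) = r) (h₄ : dist c (o + (-n) • b) < r) :
    ‖b‖ ^ 2 * (m * n) < ‖a‖ ^ 2 * (s * t) := by
  have e₁ := dist_add_smul_add_smul_sq c o a b (-s) 0
  have e₂ := dist_add_smul_add_smul_sq c o a b t 0
  have e₃ := dist_add_smul_add_smul_sq c o a b 0 m
  have e₄ := dist_add_smul_add_smul_sq c o a b 0 (-n)
  simp only [zero_smul, add_zero] at e₁ e₂ e₃ e₄
  rw [h₁] at e₁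
  rw [h₂] at e₂
  rw [h₃] at e₃
  have h₄' : dist c (o + (-n) • b) ^ 2 < r ^ 2 := pow_lt_pow_left₀ h₄ dist_nonneg two_ne_zero
  rw [e₄] at h₄'
  have hk : ‖c - o‖ ^ 2 - r ^ 2 = -(‖a‖ ^ 2 * (s * t)) := by
    have : (s + t) * (‖c - o‖ ^ 2 - r ^ 2 + ‖a‖ ^ 2 * (s * t)) = 0 := by
      linear_combination -t * e₁ - s * e₂
    have := (mul_eq_zero.mp this).resolve_left (by positivity)
    linarith
  have : 0 < (m + n) * (‖a‖ ^ 2 * (s * t) - ‖b‖ ^ 2 * (m * n)) := by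
    have h := mul_pos hm (sub_pos.mpr h₄')
    linear_combination h - n * e₃ - (m + n) * hk
  have := (mul_pos_iff_of_pos_left (by positivity)).mp this
  linarith

/-- On the side of the line through `o + m • b` and `o - n • b` that does not contain `o - s • a`,
the ball bounded by a sphere through these three points is contained in the ball bounded by a sphere
through `o - s • a`, `o + t • a` and `o + m • b`, provided the latter strictly encloses
`o - n • b`. -/
lemma dist_lt_of_dist_lt_of_nonneg {o a b c c' : V} {r r' s t m n x y : ℝ}
    (hs : 0 < s) (ht : 0 < t) (hm : 0 < m) (hn : 0 < n)
    (hlt : ‖b‖ ^ 2 * (m * n) < ‖a‖ ^ 2 * (s * t))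
    (h₁ : dist c (o + (-s) • a) = r) (h₂ : dist c (o + t • a) = r)
    (h₃ : dist c (o + m • b) = r)
    (h₁' : dist c' (o + (-s) • a) = r') (h₃' : dist c' (o + m • b) = r')
    (h₄' : dist c' (o + (-n) • b) = r')
    (hx : 0 ≤ x) (hp : dist c' (o + x • a + y • b) < r') :
    dist c (o + x • a + y • b) < r := by
  have e₁ := dist_add_smul_add_smul_sq c o a b (-s) 0
  have e₂ := dist_add_smul_add_smul_sq c o a b t 0
  have e₃ := dist_add_smul_add_smul_sq c o a b 0 m
  have e₁' := dist_add_smul_add_smul_sq c' o a b (-s) 0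
  have e₃' := dist_add_smul_add_smul_sq c' o a b 0 m
  have e₄' := dist_add_smul_add_smul_sq c' o a b 0 (-n)
  simp only [zero_smul, add_zero] at e₁ e₂ e₃ e₁' e₃' e₄'
  rw [h₁] at e₁
  rw [h₂] at e₂
  rw [h₃] at e₃
  rw [h₁'] at e₁'
  rw [h₃'] at e₃'
  rw [h₄'] at e₄'
  have hpos : 0 ≤ ‖a‖ ^ 2 * (x + s) ^ 2 + 2 * ⟪a, b⟫ * (x + s) * y + ‖b‖ ^ 2 * y ^ 2 := by
    have h := dist_add_smul_add_smul_sq 0 0 a b (x + s) y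
    simp only [sub_self, inner_zero_left, norm_zero] at h
    nlinarith [sq_nonneg (dist (0 : V) (0 + (x + s) • a + y • b))]
  have hpp : dist c' (o + x • a + y • b) ^ 2 < r' ^ 2 :=
    pow_lt_pow_left₀ hp dist_nonneg two_ne_zero
  have hr : 0 ≤ r := h₁ ▸ dist_nonneg
  refine lt_of_pow_lt_pow_left₀ 2 hr ?_
  rw [dist_add_smul_add_smul_sq] at hpp ⊢
  generalize ‖a‖ ^ 2 = A at *
  have hC : 0 ≤ ‖b‖ ^ 2 := by positivity
  generalize ‖b‖ ^ 2 = C at *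
  generalize ⟪a, b⟫ = B at *
  generalize ⟪c - o, a⟫ = X at *
  generalize ⟪c - o, b⟫ = Y at *
  generalize ⟪c' - o, a⟫ = X' at *
  generalize ⟪c' - o, b⟫ = Y' at *
  generalize ‖c - o‖ ^ 2 = k at *
  generalize ‖c' - o‖ ^ 2 = k' at *
  have hX : 2 * X = A * (t - s) := by
    have : (s + t) * (2 * X - A * (t - s)) = 0 := by linear_combination e₂ - e₁
    have := (mul_eq_zero.mp this).resolve_left (by positivity)
    linarith
  have hY' : 2 * Y' = C * (m - n) := by
    have : (m + n) * (2 * Y' - C * (m - n)) = 0 := by linear_combination e₃' - e₄'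
    have := (mul_eq_zero.mp this).resolve_left (by positivity)
    linarith
  have hk : k - r ^ 2 = -(A * (s * t)) := by linear_combination -e₁ - s * hX
  have hk' : k' - r' ^ 2 = -(C * (m * n)) := by linear_combination -e₃' + m * hY'
  have hX' : 2 * s * X' = C * (m * n) - A * s ^ 2 := by linear_combination -e₁' - hk'
  have hY : 2 * m * Y = C * m ^ 2 - A * (s * t) := by linear_combination e₃ + hk
  by_contra! hcon
  have hy : m * (x + s) < s * y := by
    have h := mul_pos (mul_pos hs hm) (sub_pos.mpr (add_lt_add_of_lt_of_le hpp hcon))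
    have hd : 0 < (A * (s * t) - C * (m * n)) * (s * y - m * (x + s)) := by
      linear_combination h - s * m * x * hX + m * x * hX' - s * y * hY + s * m * y * hY'
        + s * m * hk - s * m * hk'
    have := (mul_pos_iff_of_pos_left (sub_pos.mpr hlt)).mp hd
    linarith
  have h0 : 0 ≤ C * ((s * y - m * (x + s)) * (s * y + n * (x + s))) := by
    have h₁ : 0 ≤ m * (x + s) := by positivity
    have h₂ : 0 ≤ n * (x + s) := by positivity
    exact mul_nonneg hC (mul_nonneg (by linarith) (by linarith))
  -- the power is convex along the segment from `o - s • a` to `o + x • a + y • b`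
  have hneg := mul_pos (mul_pos hs (add_pos_of_nonneg_of_pos hx hs)) (sub_pos.mpr hpp)
  have hconv := mul_nonneg (mul_nonneg hs.le hx) hpos
  have : s * (x + s) * (r' ^ 2 -
      (A * x ^ 2 + 2 * B * x * y + C * y ^ 2 - 2 * x * X' - 2 * y * Y' + k')) =
      -(C * ((s * y - m * (x + s)) * (s * y + n * (x + s)))) -
        s * x * (A * (x + s) ^ 2 + 2 * B * (x + s) * y + C * y ^ 2) := by
    linear_combination x * (x + s) * hX' + s * y * (x + s) * hY' - s * (x + s) * hk'
  linarith

end InnerProductSpace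

/-- If the line through `v₁` and `v₂` strictly separates `v₃` and `v₄`, and conversely, then the two
lines cross at a point strictly between `v₁` and `v₂` and strictly between `v₃` and `v₄`, and their
directions are linearly independent. -/
lemma exists_crossing_of_sOppSide {V : Type*} [AddCommGroup V] [Module ℝ V]
    {v₁ v₂ v₃ v₄ : V} (h12 : v₁ ≠ v₂)
    (hopp : (affineSpan ℝ ({v₁, v₂} : Set V)).SOppSide v₃ v₄)
    (hopp' : (affineSpan ℝ ({v₃, v₄} : Set V)).SOppSide v₁ v₂) :
    ∃ (o a b : V) (s t m n : ℝ), LinearIndependent ℝ ![a, b] ∧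
      0 < s ∧ 0 < t ∧ 0 < m ∧ 0 < n ∧ v₁ = o + (-s) • a ∧ v₂ = o + t • a ∧
      v₃ = o + m • b ∧ v₄ = o + (-n) • b := by
  obtain ⟨o, ho, hbtw⟩ := hopp.exists_sbtw
  obtain ⟨o', ho', hbtw'⟩ := hopp'.exists_sbtw
  obtain ⟨k, hk⟩ := mem_affineSpan_pair_iff_exists_lineMap_eq.mp ho
  obtain ⟨l, hl⟩ := mem_affineSpan_pair_iff_exists_lineMap_eq.mp ho'
  obtain ⟨⟨m, ⟨hm0, hm1⟩, hm⟩, -⟩ := sbtw_iff_mem_image_Ioo_and_ne.mp hbtw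
  obtain ⟨⟨s, ⟨hs0, hs1⟩, hs⟩, -⟩ := sbtw_iff_mem_image_Ioo_and_ne.mp hbtw'
  have hne : ∀ q : ℝ, q • (v₂ - v₁) ≠ v₃ - v₄ := by
    intro q hq
    refine hopp.left_notMem (mem_affineSpan_pair_iff_exists_lineMap_eq.mpr ⟨k + m * q, ?_⟩)
    rw [AffineMap.lineMap_apply_module'] at hk hm ⊢
    linear_combination (norm := module) hk - hm + m • hq
  have hml : m = l := by
    by_contra h
    refine hne ((s - k) / (m - l)) ?_
    have hml' : m - l ≠ 0 := sub_ne_zero.mpr h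
    rw [div_eq_inv_mul, mul_smul, inv_smul_eq_iff₀ hml']
    rw [AffineMap.lineMap_apply_module'] at hk hm hs hl
    linear_combination (norm := module) hs - hl - hk + hm
  have hoo : o' = o := by rw [← hl, ← hm, hml]
  subst hoo
  rw [AffineMap.lineMap_apply_module'] at hm hs
  refine ⟨o', v₂ - v₁, v₃ - v₄, s, 1 - s, m, 1 - m,
    (LinearIndependent.pair_iff' (sub_ne_zero.mpr h12.symm)).mpr hne,
    hs0, sub_pos.mpr hs1, hm0, sub_pos.mpr hm1, ?_, ?_, ?_, ?_⟩
  · rw [← hs]; module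
  · rw [← hs]; module
  · rw [← hm]; module
  · rw [← hm]; module

/-- After a Delaunay flip, the intersection of the open circumdisks is contained in the
intersection of the open circumdisks before the flip. -/
theorem delaunay_flip_inter_circumdisks_subset
    (v₁ v₂ v₃ v₄ : EuclideanSpace ℝ (Fin 2)) (h12 : v₁ ≠ v₂) (h34 : v₃ ≠ v₄)
    (hopp : (affineSpan ℝ ({v₁, v₂} : Set (EuclideanSpace ℝ (Fin 2)))).SOppSide v₃ v₄)
    (hopp' : (affineSpan ℝ ({v₃, v₄} : Set (EuclideanSpace ℝ (Fin 2)))).SOppSide v₁ v₂)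
    (c₁ : EuclideanSpace ℝ (Fin 2)) (r₁ : ℝ)
    (hc₁₁ : dist c₁ v₁ = r₁) (hc₁₂ : dist c₁ v₂ = r₁) (hc₁₃ : dist c₁ v₃ = r₁)
    (c₂ : EuclideanSpace ℝ (Fin 2)) (r₂ : ℝ)
    (hc₂₁ : dist c₂ v₁ = r₂) (hc₂₂ : dist c₂ v₂ = r₂) (hc₂₄ : dist c₂ v₄ = r₂)
    (c'₁ : EuclideanSpace ℝ (Fin 2)) (r'₁ : ℝ)
    (hc'₁₃ : dist c'₁ v₃ = r'₁) (hc'₁₄ : dist c'₁ v₄ = r'₁) (hc'₁₁ : dist c'₁ v₁ = r'₁)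
    (c'₂ : EuclideanSpace ℝ (Fin 2)) (r'₂ : ℝ)
    (hc'₂₃ : dist c'₂ v₃ = r'₂) (hc'₂₄ : dist c'₂ v₄ = r'₂) (hc'₂₂ : dist c'₂ v₂ = r'₂)
    (hflip : dist c₁ v₄ < r₁) :
    Metric.ball c'₁ r'₁ ∩ Metric.ball c'₂ r'₂ ⊆ Metric.ball c₁ r₁ ∩ Metric.ball c₂ r₂ := by
  obtain ⟨o, a, b, s, t, m, n, hli, hs, ht, hm, hn, rfl, rfl, rfl, rfl⟩ :=
    exists_crossing_of_sOppSide h12 hopp hopp'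
  have hlt := mul_norm_sq_lt_of_dist_lt hs ht hm hn hc₁₁ hc₁₂ hc₁₃ (hc₁₁ ▸ hflip)
  rintro p ⟨hp₁, hp₂⟩
  have hspan := hli.span_eq_top_of_card_eq_finrank (by simp)
  have hmem : p - o ∈ Submodule.span ℝ {a, b} := by
    simpa [Set.pair_comm] using hspan.ge (Submodule.mem_top (x := p - o))
  obtain ⟨x, y, hxy⟩ := Submodule.mem_span_pair.mp hmem
  obtain rfl : p = o + x • a + y • b := by rw [add_assoc, hxy, add_sub_cancel]
  rw [Metric.mem_ball'] at hp₁ hp₂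
  rw [Set.mem_inter_iff, Metric.mem_ball', Metric.mem_ball']
  rcases le_total 0 x with hx | hx
  · refine ⟨dist_lt_of_dist_lt_of_nonneg hs ht hm hn hlt hc₁₁ hc₁₂ hc₁₃ hc'₁₁ hc'₁₃ hc'₁₄ hx hp₁,
      ?_⟩
    have h := dist_lt_of_dist_lt_of_nonneg (o := o) (a := a) (b := -b) (x := x) (y := -y)
      (r := r₂) (r' := r'₁) (c := c₂) (c' := c'₁) hs ht hn hm
    simp only [norm_neg, smul_neg, neg_smul, neg_neg, mul_comm n m] at *
    exact h hlt hc₂₁ hc₂₂ hc₂₄ hc'₁₁ hc'₁₄ hc'₁₃ hx hp₁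
  · have h₁ := dist_lt_of_dist_lt_of_nonneg (o := o) (a := -a) (b := b) (x := -x) (y := y)
      (r := r₁) (r' := r'₂) (c := c₁) (c' := c'₂) ht hs hm hn
    have h₂ := dist_lt_of_dist_lt_of_nonneg (o := o) (a := -a) (b := -b) (x := -x) (y := -y)
      (r := r₂) (r' := r'₂) (c := c₂) (c' := c'₂) ht hs hn hm
    simp only [norm_neg, smul_neg, neg_smul, neg_neg, mul_comm n m, mul_comm t s, neg_nonneg] at *
    exact ⟨h₁ hlt hc₁₂ hc₁₁ hc₁₃ hc'₂₂ hc'₂₃ hc'₂₄ hx hp₂,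
      h₂ hlt hc₂₂ hc₂₁ hc₂₄ hc'₂₂ hc'₂₄ hc'₂₃ hx hp₂⟩
end

section
/- Let v₁, v₂, v₃, v₄ ∈ E with v₁ ≠ v₂ and v₃ ≠ v₄, suppose v₃ and v₄ lie strictly on opposite sides of the line through v₁ and v₂, and v₁ and v₂ lie strictly on opposite sides of the line through v₃ and v₄. Let (c₁, r₁), (c₂, r₂), (c'₁, r'₁), (c'₂, r'₂) be circumcenter–circumradius pairs for the triples (v₁, v₂, v₃), (v₁, v₂, v₄), (v₃, v₄, v₁), (v₃, v₄, v₂) respectively, and assume dist c₁ v₄ < r₁. Then for every finite set P ⊆ E with v₃ ∈ P and v₄ ∈ P, the total number of points of P in the two open circumdisks drops by at least 2 under the flip: Nat.card (P ∩ Metric.ball c'₁ r'₁) + Nat.card (P ∩ Metric.ball c'₂ r'₂) + 2 ≤ Nat.card (P ∩ Metric.ball c₁ r₁) + Nat.card (P ∩ Metric.ball c₂ r₂). (A Delaunay flip decreases the weight of the triangulation by at least 2.) -/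
lemma power_neg_iff {E : Type*} [PseudoMetricSpace E] {e x y : E} {r : ℝ} (h : dist e y = r) :
    dist e x ^ 2 - r ^ 2 < 0 ↔ dist e x < r := by
  rw [sub_neg, sq_lt_sq₀ dist_nonneg (h ▸ dist_nonneg)]

section Disks

variable {E : Type*} [NormedAddCommGroup E] [InnerProductSpace ℝ E]

lemma dist_lt_of_convex_combination {e x y z : E} {r α β γ : ℝ}
    (hx : dist e x < r) (hy : dist e y ≤ r) (hz : dist e z ≤ r)
    (hα : 0 < α) (hβ : 0 ≤ β) (hγ : 0 ≤ γ) (hsum : α + β + γ = 1) :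
    dist e (α • x + β • y + γ • z) < r := by
  rw [dist_eq_norm] at *
  have key : e - (α • x + β • y + γ • z) = α • (e - x) + β • (e - y) + γ • (e - z) := by
    have : e = (α + β + γ) • e := by rw [hsum, one_smul]
    nth_rewrite 1 [this]
    module
  calc ‖e - (α • x + β • y + γ • z)‖
      ≤ ‖α • (e - x)‖ + ‖β • (e - y)‖ + ‖γ • (e - z)‖ := by rw [key]; exact norm_add₃_le
    _ = α * ‖e - x‖ + β * ‖e - y‖ + γ * ‖e - z‖ := by
        rw [norm_smul, norm_smul, norm_smul, Real.norm_of_nonneg hα.le, Real.norm_of_nonneg hβ,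
          Real.norm_of_nonneg hγ]
    _ < α * r + β * r + γ * r := by
        have := mul_lt_mul_of_pos_left hx hα
        have := mul_le_mul_of_nonneg_left hy hβ
        have := mul_le_mul_of_nonneg_left hz hγ
        linarith
    _ = r := by rw [← add_mul, ← add_mul, hsum, one_mul]

/-- A disk whose boundary circle passes through the three vertices of a triangle misses the cone
opposite to the triangle at a vertex. -/
lemma le_dist_of_mem_opposite_cone {o u w e : E} {r a c d p q : ℝ}
    (ha : 0 < a) (hc : 0 < c) (hd : 0 < d) (hcd : c + d = 1)
    (h₁ : dist e (o + a • u) = r) (h₃ : dist e (o + c • w) = r) (h₄ : dist e (o + (-d) • w) = r)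
    (hpc : 0 < c * (p - a) + a * q) (hpd : 0 < d * (p - a) - a * q) :
    r ≤ dist e (o + p • u + q • w) := by
  by_contra! hx
  have hpa : 0 < p - a := by nlinarith
  have hp : 0 < p := by linarith
  have := dist_lt_of_convex_combination hx h₃.le h₄.le (α := a / p)
    (β := (d * (p - a) - a * q) / p) (γ := (c * (p - a) + a * q) / p) (by positivity)
    (by positivity) (by positivity) (by
      field_simp
      linear_combination (p - a) * hcd)
  refine this.ne (Eq.trans (congrArg _ ?_) h₁)
  have hd' : d = 1 - c := by linarith
  subst hd'
  match_scalars <;> field_simp <;> ring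

/-- If a circle through the end points `o + c • w`, `o - d • w` of a diagonal of a convex
quadrilateral passes through a third vertex `o + a • u`, its disk misses the part of the cone
opposite to the quadrilateral at `o + c • w` that lies across the diagonal. -/
lemma le_dist_of_mem_opposite_half_cone {o u w e : E} {r a c d p q : ℝ}
    (ha : 0 < a) (hc : 0 < c) (hd : 0 < d) (hcd : c + d = 1)
    (h₁ : dist e (o + a • u) = r) (h₃ : dist e (o + c • w) = r) (h₄ : dist e (o + (-d) • w) = r)
    (hpq : 0 < c * p + a * (q - c)) (hp : p ≤ 0) :
    r ≤ dist e (o + p • u + q • w) := by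
  by_contra! hx
  have hqc : 0 < q - c := by nlinarith
  have hq : 0 < q := by linarith
  have ho : dist e o ≤ r := by
    have := (convex_closedBall e r) (x := o + c • w) (by simp [dist_comm, ← h₃])
      (y := o + (-d) • w) (by simp [dist_comm, ← h₄]) hd.le hc.le (by linarith)
    rw [Metric.mem_closedBall, dist_comm] at this
    convert this using 2
    have hd' : d = 1 - c := by linarith
    subst hd'
    module
  have hp' : 0 ≤ -p := by linarith
  have := dist_lt_of_convex_combination hx h₁.le ho (α := c / q)
    (β := c * (-p) / (q * a)) (γ := (c * p + a * (q - c)) / (q * a)) (by positivity)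
    (by positivity) (by positivity) (by field_simp; ring)
  refine this.ne (Eq.trans (congrArg _ ?_) h₃)
  match_scalars <;> field_simp <;> ring

lemma exists_power_eq (o u w e : E) (r : ℝ) : ∃ k m n : ℝ, ∀ p q : ℝ,
    dist e (o + p • u + q • w) ^ 2 - r ^ 2 = ‖p • u + q • w‖ ^ 2 + k + p * m + q * n := by
  refine ⟨‖o - e‖ ^ 2 - r ^ 2, 2 * inner ℝ u (o - e), 2 * inner ℝ w (o - e), fun p q => ?_⟩
  have : o + p • u + q • w - e = (p • u + q • w) + (o - e) := by abel
  rw [dist_comm, dist_eq_norm, this, norm_add_sq_real, inner_add_left, real_inner_smul_left,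
    real_inner_smul_left]
  ring

lemma power_eq_of_chord {o u e e' : E} {r r' a b : ℝ} (ha : 0 < a) (hb : 0 < b)
    (h₁ : dist e (o + a • u) = r) (h₂ : dist e (o + (-b) • u) = r)
    (h₁' : dist e' (o + a • u) = r') (h₂' : dist e' (o + (-b) • u) = r') :
    dist e o ^ 2 - r ^ 2 = dist e' o ^ 2 - r' ^ 2 := by
  obtain ⟨k, m, n, h⟩ := exists_power_eq o u 0 e r
  obtain ⟨k', m', n', h'⟩ := exists_power_eq o u 0 e' r'
  have ea := h a 0
  have eb := h (-b) 0
  have eo := h 0 0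
  have ea' := h' a 0
  have eb' := h' (-b) 0
  have eo' := h' 0 0
  simp only [zero_smul, smul_zero, add_zero, h₁, h₂, h₁', h₂', sub_self] at ea eb eo ea' eb' eo'
  have hab : a + b ≠ 0 := by positivity
  refine mul_left_cancel₀ hab ?_
  linear_combination (a + b) * eo - (a + b) * eo' - b * (ea - ea') - a * (eb - eb')

/-- The difference of the powers of a point with respect to two circles through `o + a • u` and
`o + c • w`, in the affine coordinates `(p, q)`. -/
lemma mul_power_sub_power {o u w e e' : E} {r r' a c : ℝ}
    (h₁ : dist e (o + a • u) = r) (h₃ : dist e (o + c • w) = r)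
    (h₁' : dist e' (o + a • u) = r') (h₃' : dist e' (o + c • w) = r') (p q : ℝ) :
    a * c * ((dist e (o + p • u + q • w) ^ 2 - r ^ 2) -
        (dist e' (o + p • u + q • w) ^ 2 - r' ^ 2)) =
      ((dist e' o ^ 2 - r' ^ 2) - (dist e o ^ 2 - r ^ 2)) * (c * p + a * q - a * c) := by
  obtain ⟨k, m, n, h⟩ := exists_power_eq o u w e r
  obtain ⟨k', m', n', h'⟩ := exists_power_eq o u w e' r'
  have ea := h a 0
  have ec := h 0 c
  have eo := h 0 0
  have ea' := h' a 0
  have ec' := h' 0 c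
  have eo' := h' 0 0
  simp only [zero_smul, add_zero, zero_add, h₁, h₃, h₁', h₃', sub_self] at ea ec eo ea' ec' eo'
  rw [h, h', eo, eo']
  linear_combination -c * p * (ea - ea') - a * q * (ec - ec')

/-- Replacing the diagonal of a convex quadrilateral with vertices `o + a • u`, `o - b • u`,
`o + c • w`, `o - d • w` by the other one shrinks both the union and the intersection of the
two circumdisks. -/
lemma flip_disks {o u w : E} {a b c d : ℝ} (ha : 0 < a) (hb : 0 < b) (hc : 0 < c) (hd : 0 < d)
    (hcd : c + d = 1) {c₁ c₂ c'₁ c'₂ : E} {r₁ r₂ r'₁ r'₂ : ℝ}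
    (h₁₁ : dist c₁ (o + a • u) = r₁) (h₁₂ : dist c₁ (o + (-b) • u) = r₁)
    (h₁₃ : dist c₁ (o + c • w) = r₁)
    (h₂₁ : dist c₂ (o + a • u) = r₂) (h₂₂ : dist c₂ (o + (-b) • u) = r₂)
    (h₂₄ : dist c₂ (o + (-d) • w) = r₂)
    (h'₁₃ : dist c'₁ (o + c • w) = r'₁) (h'₁₄ : dist c'₁ (o + (-d) • w) = r'₁)
    (h'₁₁ : dist c'₁ (o + a • u) = r'₁)
    (h'₂₃ : dist c'₂ (o + c • w) = r'₂) (h'₂₄ : dist c'₂ (o + (-d) • w) = r'₂)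
    (h'₂₂ : dist c'₂ (o + (-b) • u) = r'₂)
    (hflip : dist c₁ (o + (-d) • w) < r₁) :
    dist c₂ (o + c • w) < r₂ ∧ ∀ p q : ℝ, ∀ x, x = o + p • u + q • w →
      (dist c'₁ x < r'₁ → dist c₁ x < r₁ ∨ dist c₂ x < r₂) ∧
      (dist c'₂ x < r'₂ → dist c₁ x < r₁ ∨ dist c₂ x < r₂) ∧
      (dist c'₁ x < r'₁ → dist c'₂ x < r'₂ → dist c₁ x < r₁ ∧ dist c₂ x < r₂) := by
  have hF := power_eq_of_chord ha hb h₁₁ h₁₂ h₂₁ h₂₂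
  have hG := power_eq_of_chord hc hd h'₁₃ h'₁₄ h'₂₃ h'₂₄
  have k₁₁ := mul_power_sub_power h₁₁ h₁₃ h'₁₁ h'₁₃
  have k₁₂ := mul_power_sub_power h₁₂ h₁₃ h'₂₂ h'₂₃
  have k₂₁ := mul_power_sub_power h₂₁ h₂₄ h'₁₁ h'₁₄
  have k₂₂ := mul_power_sub_power h₂₂ h₂₄ h'₂₂ h'₂₄
  rw [← hG] at k₁₂ k₂₂
  rw [← hF] at k₂₁ k₂₂
  set D := (dist c'₁ o ^ 2 - r'₁ ^ 2) - (dist c₁ o ^ 2 - r₁ ^ 2)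
  have hD : 0 < D := by
    have h := k₁₁ 0 (-d)
    rw [← power_neg_iff h₁₁] at hflip
    simp only [zero_smul, add_zero, h'₁₄, sub_self, sub_zero] at h
    have h2 : a * c * (dist c₁ (o + (-d) • w) ^ 2 - r₁ ^ 2) < 0 :=
      mul_neg_of_pos_of_neg (by positivity) hflip
    have h3 : 0 < a * d + a * c := by positivity
    nlinarith
  constructor
  · have h := k₂₁ 0 c
    rw [← power_neg_iff h₂₁]
    simp only [zero_smul, add_zero, h'₁₃, sub_self, sub_zero] at h
    have h2 : 0 < D * (a * d + a * c) := by positivity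
    have h3 : 0 < a * d := by positivity
    nlinarith
  · intro p q x hx
    have pos_of_lt {s t F G : ℝ} (hF : ¬ F < 0) (hG : G < 0) (hs : 0 < s)
        (h : s * (F - G) = D * t) : 0 < t := by
      have : 0 < D * t := h ▸ mul_pos hs (by linarith)
      exact (mul_pos_iff_of_pos_left hD).1 this
    have e₁₁ := k₁₁ p q
    have e₁₂ := k₁₂ p q
    have e₂₁ := k₂₁ p q
    have e₂₂ := k₂₂ p q
    rw [← hx] at e₁₁ e₁₂ e₂₁ e₂₂
    have hx' : x = o + (-p) • (-u) + q • w := by rw [hx]; module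
    have hx₄ : x = o + p • u + (-q) • (-w) := by rw [hx]; module
    have hx₄' : x = o + (-p) • (-u) + (-q) • (-w) := by rw [hx]; module
    have l₁₁ (hF : ¬ dist c₁ x < r₁) (hG : dist c'₁ x < r'₁) : 0 < c * p + a * q - a * c := by
      rw [← power_neg_iff h₁₁] at hF
      rw [← power_neg_iff h'₁₁] at hG
      exact pos_of_lt hF hG (mul_pos ha hc) e₁₁
    have l₁₂ (hF : ¬ dist c₁ x < r₁) (hG : dist c'₂ x < r'₂) : 0 < -c * p + b * q - b * c := by
      rw [← power_neg_iff h₁₁] at hF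
      rw [← power_neg_iff h'₂₂] at hG
      exact pos_of_lt hF hG (mul_pos hb hc) (by linear_combination -e₁₂)
    have l₂₁ (hF : ¬ dist c₂ x < r₂) (hG : dist c'₁ x < r'₁) : 0 < d * p - a * q - a * d := by
      rw [← power_neg_iff h₂₁] at hF
      rw [← power_neg_iff h'₁₁] at hG
      exact pos_of_lt hF hG (mul_pos ha hd) (by linear_combination -e₂₁)
    have l₂₂ (hF : ¬ dist c₂ x < r₂) (hG : dist c'₂ x < r'₂) : 0 < -d * p - b * q - b * d := by
      rw [← power_neg_iff h₂₁] at hF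
      rw [← power_neg_iff h'₂₂] at hG
      exact pos_of_lt hF hG (mul_pos hb hd) (by linear_combination e₂₂)
    rw [neg_smul, ← smul_neg] at h'₂₂
    refine ⟨fun hG => ?_, fun hG => ?_, fun hG₁ hG₂ => ⟨?_, ?_⟩⟩
    · by_contra! h
      refine hG.not_ge (hx ▸ le_dist_of_mem_opposite_cone ha hc hd hcd h'₁₁ h'₁₃ h'₁₄ ?_ ?_)
      · linarith [l₁₁ h.1.not_gt hG]
      · linarith [l₂₁ h.2.not_gt hG]
    · by_contra! h
      refine hG.not_ge (hx' ▸ le_dist_of_mem_opposite_cone hb hc hd hcd h'₂₂ h'₂₃ h'₂₄ ?_ ?_)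
      · linarith [l₁₂ h.1.not_gt hG]
      · linarith [l₂₂ h.2.not_gt hG]
    · by_contra h
      rcases le_total p 0 with hp | hp
      · refine hG₁.not_ge (hx ▸ le_dist_of_mem_opposite_half_cone ha hc hd hcd h'₁₁ h'₁₃ h'₁₄
          ?_ hp)
        linarith [l₁₁ h hG₁]
      · refine hG₂.not_ge (hx' ▸ le_dist_of_mem_opposite_half_cone hb hc hd hcd h'₂₂ h'₂₃ h'₂₄
          ?_ (by linarith))
        linarith [l₁₂ h hG₂]
    · by_contra h
      have hdc : d + c = 1 := by linarith
      rw [neg_smul, ← smul_neg] at h'₁₄ h'₂₄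
      rw [← neg_smul_neg] at h'₁₃ h'₂₃
      rcases le_total p 0 with hp | hp
      · refine hG₁.not_ge (hx₄ ▸ le_dist_of_mem_opposite_half_cone ha hd hc hdc h'₁₁ h'₁₄ h'₁₃
          ?_ hp)
        linarith [l₂₁ h hG₁]
      · refine hG₂.not_ge (hx₄' ▸ le_dist_of_mem_opposite_half_cone hb hd hc hdc h'₂₂ h'₂₄ h'₂₃
          ?_ (by linarith))
        linarith [l₂₂ h hG₂]

end Disks

lemma Set.ncard_add_ncard_add_two_le {α : Type*} {A B C D : Set α} (hC : C.Finite) (hD : D.Finite)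
    {y z : α} (hyz : y ≠ z) (hunion : A ∪ B ⊆ C ∪ D) (hinter : A ∩ B ⊆ C ∩ D)
    (hy : y ∈ C ∪ D) (hz : z ∈ C ∪ D) (hy' : y ∉ A ∪ B) (hz' : z ∉ A ∪ B) :
    A.ncard + B.ncard + 2 ≤ C.ncard + D.ncard := by
  have hCD := hC.union hD
  have hAB := hCD.subset hunion
  have hA := hAB.subset Set.subset_union_left
  have hB := hAB.subset Set.subset_union_right
  have h := Set.ncard_le_ncard (s := insert y (insert z (A ∪ B)))
    (Set.insert_subset hy (Set.insert_subset hz hunion)) hCD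
  rw [Set.ncard_insert_of_notMem (by simp_all) (hAB.insert z),
    Set.ncard_insert_of_notMem hz' hAB] at h
  have h' := Set.ncard_le_ncard hinter (hC.subset Set.inter_subset_left)
  have := Set.ncard_union_add_ncard_inter A B hA hB
  have := Set.ncard_union_add_ncard_inter C D hC hD
  omega

/-- Two segments in the plane, each of which separates the end points of the other, cross, and
their directions span the plane. -/
lemma exists_crossing_coordinates {v₁ v₂ v₃ v₄ : EuclideanSpace ℝ (Fin 2)}
    (hopp : (affineSpan ℝ ({v₁, v₂} : Set (EuclideanSpace ℝ (Fin 2)))).SOppSide v₃ v₄)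
    (hopp' : (affineSpan ℝ ({v₃, v₄} : Set (EuclideanSpace ℝ (Fin 2)))).SOppSide v₁ v₂) :
    ∃ (o u w : EuclideanSpace ℝ (Fin 2)) (a b c d : ℝ), 0 < a ∧ 0 < b ∧ 0 < c ∧ 0 < d ∧
      c + d = 1 ∧ v₁ = o + a • u ∧ v₂ = o + (-b) • u ∧ v₃ = o + c • w ∧ v₄ = o + (-d) • w ∧
      ∀ x, ∃ p q : ℝ, x = o + p • u + q • w := by
  obtain ⟨o, ho, hso⟩ := hopp.exists_sbtw
  obtain ⟨o', ho', hso'⟩ := hopp'.exists_sbtw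
  obtain ⟨s, rfl⟩ := (mem_affineSpan_pair_iff_exists_lineMap_eq).1 ho
  obtain ⟨t', rfl⟩ := (mem_affineSpan_pair_iff_exists_lineMap_eq).1 ho'
  obtain ⟨t, ht, hto⟩ := sbtw_iff_mem_image_Ioo_and_ne.1 hso |>.1
  obtain ⟨s', hs', hso'⟩ := sbtw_iff_mem_image_Ioo_and_ne.1 hso' |>.1
  have hpar : ∀ k : ℝ, v₁ - v₂ ≠ k • (v₃ - v₄) := by
    intro k hk
    apply hopp'.2.1
    rw [mem_affineSpan_pair_iff_exists_lineMap_eq]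
    refine ⟨t' - s' * k, ?_⟩
    simp only [AffineMap.lineMap_apply_module'] at *
    have e : v₁ = (s' • (v₁ - v₂)) + (t' • (v₄ - v₃) + v₃) := by rw [← hso']; module
    nth_rewrite 1 [e]
    rw [hk]
    module
  have hw : v₃ - v₄ ≠ 0 := by
    intro h
    exact hso.left_ne_right (sub_eq_zero.1 h)
  have hspan : ∀ y : EuclideanSpace ℝ (Fin 2), ∃ p q : ℝ, y = p • (v₁ - v₂) + q • (v₃ - v₄) := by
    have hli : LinearIndependent ℝ ![v₃ - v₄, v₁ - v₂] := by
      rw [LinearIndependent.pair_iff' hw]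
      exact fun k hk => hpar k hk.symm
    have htop := hli.span_eq_top_of_card_eq_finrank (by simp)
    intro y
    have hy : y ∈ Submodule.span ℝ (Set.range ![v₃ - v₄, v₁ - v₂]) := htop ▸ Submodule.mem_top
    simp only [Matrix.range_cons, Matrix.range_empty, Set.union_empty,
      Set.singleton_union, Submodule.mem_span_pair] at hy
    obtain ⟨q, p, rfl⟩ := hy
    exact ⟨p, q, add_comm _ _⟩
  have hs : s = s' := by
    by_contra hne
    simp only [AffineMap.lineMap_apply_module'] at hto hso'
    apply hpar ((s - s')⁻¹ * (t - t'))
    have h : (s - s') • (v₁ - v₂) = (t - t') • (v₃ - v₄) := by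
      linear_combination (norm := module) hto + hso'
    rw [mul_smul, ← h, inv_smul_smul₀ (sub_ne_zero.2 hne)]
  subst hs
  refine ⟨AffineMap.lineMap v₁ v₂ s, v₁ - v₂, v₃ - v₄, s, 1 - s, t, 1 - t, hs'.1,
    sub_pos.2 hs'.2, ht.1, sub_pos.2 ht.2, by ring, ?_, ?_, ?_, ?_, fun x => ?_⟩
  · rw [AffineMap.lineMap_apply_module']; module
  · rw [AffineMap.lineMap_apply_module']; module
  · rw [← hto, AffineMap.lineMap_apply_module']; module
  · rw [← hto, AffineMap.lineMap_apply_module']; module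
  · obtain ⟨p, q, h⟩ := hspan (x - AffineMap.lineMap v₁ v₂ s)
    exact ⟨p, q, by rw [add_assoc, ← h]; abel⟩

/-- A Delaunay flip decreases the weight of the triangulation by at least 2: the
total number of points of a finite set `P` (containing `v₃` and `v₄`) lying in the
two open circumdisks drops by at least 2 under the flip. -/
theorem delaunay_flip_weight_decreases
    (v₁ v₂ v₃ v₄ : EuclideanSpace ℝ (Fin 2)) (h12 : v₁ ≠ v₂) (h34 : v₃ ≠ v₄)
    (hopp : (affineSpan ℝ ({v₁, v₂} : Set (EuclideanSpace ℝ (Fin 2)))).SOppSide v₃ v₄)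
    (hopp' : (affineSpan ℝ ({v₃, v₄} : Set (EuclideanSpace ℝ (Fin 2)))).SOppSide v₁ v₂)
    (c₁ : EuclideanSpace ℝ (Fin 2)) (r₁ : ℝ)
    (hc₁₁ : dist c₁ v₁ = r₁) (hc₁₂ : dist c₁ v₂ = r₁) (hc₁₃ : dist c₁ v₃ = r₁)
    (c₂ : EuclideanSpace ℝ (Fin 2)) (r₂ : ℝ)
    (hc₂₁ : dist c₂ v₁ = r₂) (hc₂₂ : dist c₂ v₂ = r₂) (hc₂₄ : dist c₂ v₄ = r₂)
    (c'₁ : EuclideanSpace ℝ (Fin 2)) (r'₁ : ℝ)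
    (hc'₁₃ : dist c'₁ v₃ = r'₁) (hc'₁₄ : dist c'₁ v₄ = r'₁) (hc'₁₁ : dist c'₁ v₁ = r'₁)
    (c'₂ : EuclideanSpace ℝ (Fin 2)) (r'₂ : ℝ)
    (hc'₂₃ : dist c'₂ v₃ = r'₂) (hc'₂₄ : dist c'₂ v₄ = r'₂) (hc'₂₂ : dist c'₂ v₂ = r'₂)
    (hflip : dist c₁ v₄ < r₁)
    (P : Set (EuclideanSpace ℝ (Fin 2))) (hP : P.Finite) (hv₃ : v₃ ∈ P) (hv₄ : v₄ ∈ P) :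
    Nat.card (P ∩ Metric.ball c'₁ r'₁ : Set (EuclideanSpace ℝ (Fin 2))) +
      Nat.card (P ∩ Metric.ball c'₂ r'₂ : Set (EuclideanSpace ℝ (Fin 2))) + 2 ≤
    Nat.card (P ∩ Metric.ball c₁ r₁ : Set (EuclideanSpace ℝ (Fin 2))) +
      Nat.card (P ∩ Metric.ball c₂ r₂ : Set (EuclideanSpace ℝ (Fin 2))) := by
  obtain ⟨o, u, w, a, b, c, d, ha, hb, hc, hd, hcd, e₁, e₂, e₃, e₄, hcoord⟩ :=
    exists_crossing_coordinates hopp hopp'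
  obtain ⟨h₃, hx⟩ := flip_disks (o := o) (u := u) (w := w) ha hb hc hd hcd
    (e₁ ▸ hc₁₁) (e₂ ▸ hc₁₂) (e₃ ▸ hc₁₃) (e₁ ▸ hc₂₁) (e₂ ▸ hc₂₂) (e₄ ▸ hc₂₄)
    (e₃ ▸ hc'₁₃) (e₄ ▸ hc'₁₄) (e₁ ▸ hc'₁₁) (e₃ ▸ hc'₂₃) (e₄ ▸ hc'₂₄) (e₂ ▸ hc'₂₂) (e₄ ▸ hflip)
  rw [← e₃] at h₃
  simp only [Nat.card_coe_set_eq]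
  refine Set.ncard_add_ncard_add_two_le (hP.subset Set.inter_subset_left)
    (hP.subset Set.inter_subset_left) h34 ?_ ?_ (Or.inr ⟨hv₃, ?_⟩) (Or.inl ⟨hv₄, ?_⟩) ?_ ?_
  · rintro x hxG
    obtain ⟨p, q, hpq⟩ := hcoord x
    obtain ⟨k₁, k₂, -⟩ := hx p q x hpq
    rw [← Set.inter_union_distrib_left] at hxG ⊢
    simp only [Set.mem_inter_iff, Set.mem_union, Metric.mem_ball'] at hxG ⊢
    exact ⟨hxG.1, hxG.2.elim k₁ k₂⟩
  · rintro x ⟨⟨hxP, hx₁⟩, -, hx₂⟩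
    obtain ⟨p, q, hpq⟩ := hcoord x
    obtain ⟨-, -, k⟩ := hx p q x hpq
    rw [Metric.mem_ball'] at hx₁ hx₂
    obtain ⟨k₁, k₂⟩ := k hx₁ hx₂
    exact ⟨⟨hxP, Metric.mem_ball'.2 k₁⟩, hxP, Metric.mem_ball'.2 k₂⟩
  · exact Metric.mem_ball'.2 h₃
  · exact Metric.mem_ball'.2 hflip
  · simp [dist_comm _ c'₁, dist_comm _ c'₂, hc'₁₃, hc'₂₃]
  · simp [dist_comm _ c'₁, dist_comm _ c'₂, hc'₁₄, hc'₂₄]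
end

section
/- Let p₁, p₂, p₃ ∈ ℝ² be pairwise distinct points admitting a circumcenter–circumradius pair (c, r) (so dist c pᵢ = r for i = 1, 2, 3), and let q ∈ ℝ². Then dist c q < r if and only if the lifted points L q and s₀ = (0, 0, −1) lie strictly on opposite sides of the plane through L p₁, L p₂, L p₃, i.e. (affineSpan ℝ {L p₁, L p₂, L p₃}).SOppSide (L q) s₀. (A point lies strictly inside the circumcircle of three points exactly when its lift to the sphere lies strictly below the plane through the three lifted points, on the side of the projection pole; this is the correspondence between Delaunay flippable edges and concave edges of the lifted polyhedral surface.) -/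
/-- The inverse stereographic projection from the south pole `s₀ = (0, 0, -1)` of the
unit sphere, sending the plane `z = 1` (identified with `ℝ²`) to the unit sphere. -/
noncomputable def sphereLift (x : EuclideanSpace ℝ (Fin 2)) : EuclideanSpace ℝ (Fin 3) :=
  (WithLp.equiv 2 (Fin 3 → ℝ)).symm
    ![4 * x 0 / (x 0 ^ 2 + x 1 ^ 2 + 4),
      4 * x 1 / (x 0 ^ 2 + x 1 ^ 2 + 4),
      (4 - x 0 ^ 2 - x 1 ^ 2) / (4 + x 0 ^ 2 + x 1 ^ 2)]

/-- The south pole `s₀ = (0, 0, -1)` of the unit sphere. -/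
noncomputable def southPole : EuclideanSpace ℝ (Fin 3) := (WithLp.equiv 2 (Fin 3 → ℝ)).symm ![0, 0, -1]

open Module

/-- Strict separation by the zero set of a real affine function is detected by signs. -/
theorem AffineSubspace.sOppSide_iff_mul_neg_of_mem_iff {V P : Type*} [AddCommGroup V] [Module ℝ V]
    [AddTorsor V P] {s : AffineSubspace ℝ P} {F : P →ᵃ[ℝ] ℝ} (hs : ∀ v, v ∈ s ↔ F v = 0)
    (x y : P) : s.SOppSide x y ↔ F x * F y < 0 := by
  constructor
  · rintro ⟨⟨p, hp, p', hp', hray⟩, hx, hy⟩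
    rw [hs] at hp hp' hx hy
    have hray := hray.map F.linear
    simp only [AffineMap.linearMap_vsub, hp, hp', vsub_eq_sub, sub_zero, zero_sub] at hray
    rcases hray with h | h | ⟨a, b, ha, hb, h⟩
    · exact absurd h hx
    · exact absurd (neg_eq_zero.mp h) hy
    · simp only [smul_eq_mul] at h
      have hy2 : 0 < F y ^ 2 := by positivity
      have : a * (F x * F y) < 0 := by
        have : a * (F x * F y) = -(b * F y ^ 2) := by linear_combination F y * h
        rw [this]
        exact neg_neg_of_pos (mul_pos hb hy2)
      exact (pos_iff_neg_of_mul_neg this).mp ha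
  · intro h
    have hx : F x ≠ 0 := by rintro h0; simp [h0] at h
    have hy : F y ≠ 0 := by rintro h0; simp [h0] at h
    have hxy : F x - F y ≠ 0 := by
      intro h0
      rw [sub_eq_zero.mp h0] at h
      exact absurd h (not_lt.mpr (mul_self_nonneg _))
    have hne : x ≠ y := by rintro rfl; simp at hxy
    have ht : F x / (F x - F y) ∈ Set.Ioo (0 : ℝ) 1 := by
      rcases mul_neg_iff.mp h with ⟨h1, h2⟩ | ⟨h1, h2⟩
      · exact ⟨div_pos h1 (by linarith), (div_lt_one (by linarith)).mpr (by linarith)⟩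
      · exact ⟨div_pos_of_neg_of_neg h1 (by linarith),
          (div_lt_one_of_neg (by linarith)).mpr (by linarith)⟩
    refine Sbtw.sOppSide_of_notMem_of_mem (y := AffineMap.lineMap x y (F x / (F x - F y)))
      (sbtw_lineMap_iff.mpr ⟨hne, ht⟩) (by rwa [hs]) ?_
    rw [hs, AffineMap.apply_lineMap, AffineMap.lineMap_apply_ring']
    field_simp
    ring

/-- The plane through three affinely independent points of a three-dimensional space is the zero
set of any nonconstant affine function vanishing at these points. -/
theorem mem_affineSpan_triple_iff_of_finrank_eq_three {V P : Type*} [AddCommGroup V] [Module ℝ V]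
    [AddTorsor V P] (hV : finrank ℝ V = 3) {a b c : P} (hi : AffineIndependent ℝ ![a, b, c])
    {F : P →ᵃ[ℝ] ℝ} (hF : F.linear ≠ 0) (ha : F a = 0) (hb : F b = 0) (hc : F c = 0) (v : P) :
    v ∈ affineSpan ℝ {a, b, c} ↔ F v = 0 := by
  have : FiniteDimensional ℝ V := FiniteDimensional.of_finrank_pos (by omega)
  have mem (v : P) : v ∈ AffineSubspace.mk' a F.linear.ker ↔ F v = 0 := by
    rw [AffineSubspace.mem_mk', LinearMap.mem_ker, AffineMap.linearMap_vsub, ha, vsub_eq_sub,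
      sub_zero]
  have hker : finrank ℝ F.linear.ker = 2 := by
    have := Module.Dual.finrank_ker_add_one_of_ne_zero (f := F.linear) hF
    omega
  have hr : Set.range ![a, b, c] = {a, b, c} := by
    simp only [Matrix.range_cons, Matrix.range_empty, Set.union_empty, Set.singleton_union]
  rw [← hr, hi.affineSpan_eq_of_le_of_card_eq_finrank_add_one (sp := .mk' a F.linear.ker), mem]
  · rw [hr, affineSpan_le]
    rintro x (rfl | rfl | rfl) <;> simpa only [SetLike.mem_coe, mem]
  · rw [AffineSubspace.direction_mk', hker]
    rfl

theorem norm_sphereLift (x : EuclideanSpace ℝ (Fin 2)) : ‖sphereLift x‖ = 1 := by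
  have h : x 0 ^ 2 + x 1 ^ 2 + 4 ≠ 0 := by positivity
  have h' : 4 + x 0 ^ 2 + x 1 ^ 2 ≠ 0 := by positivity
  rw [← sq_eq_sq₀ (norm_nonneg _) zero_le_one, EuclideanSpace.real_norm_sq_eq, Fin.sum_univ_three]
  simp only [sphereLift, WithLp.equiv_symm_apply, PiLp.toLp_apply, Matrix.cons_val]
  field_simp
  ring

theorem sphereLift_injective : Function.Injective sphereLift := by
  intro x y hxy
  have hx : 0 < x 0 ^ 2 + x 1 ^ 2 + 4 := by positivity
  have hy : 0 < y 0 ^ 2 + y 1 ^ 2 + 4 := by positivity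
  have h0 := congrArg (· 0) hxy
  have h1 := congrArg (· 1) hxy
  have h2 := congrArg (· 2) hxy
  simp only [sphereLift, WithLp.equiv_symm_apply, PiLp.toLp_apply, Matrix.cons_val] at h0 h1 h2
  have hN : x 0 ^ 2 + x 1 ^ 2 + 4 = y 0 ^ 2 + y 1 ^ 2 + 4 := by
    rw [div_eq_div_iff (by positivity) (by positivity)] at h2
    linarith
  rw [hN, div_left_inj' hy.ne'] at h0 h1
  ext i
  fin_cases i
  · simpa using h0
  · simpa using h1

/-- The affine function on space whose zero set cuts the unit sphere along the lift of the circle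
with center `c` and radius `r`. -/
noncomputable def circlePlane (c : EuclideanSpace ℝ (Fin 2)) (r : ℝ) :
    EuclideanSpace ℝ (Fin 3) →ᵃ[ℝ] ℝ :=
  ((-(c 0 / 2)) • EuclideanSpace.projₗ 0 + (-(c 1 / 2)) • EuclideanSpace.projₗ 1 +
    ((c 0 ^ 2 + c 1 ^ 2 - r ^ 2) / 8 - 1 / 2) • EuclideanSpace.projₗ 2 :
      EuclideanSpace ℝ (Fin 3) →ₗ[ℝ] ℝ).toAffineMap +
    AffineMap.const ℝ _ ((c 0 ^ 2 + c 1 ^ 2 - r ^ 2) / 8 + 1 / 2)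

theorem circlePlane_apply (c : EuclideanSpace ℝ (Fin 2)) (r : ℝ) (v : EuclideanSpace ℝ (Fin 3)) :
    circlePlane c r v = -(c 0 / 2) * v 0 + -(c 1 / 2) * v 1 +
      ((c 0 ^ 2 + c 1 ^ 2 - r ^ 2) / 8 - 1 / 2) * v 2 +
        ((c 0 ^ 2 + c 1 ^ 2 - r ^ 2) / 8 + 1 / 2) := by
  simp [circlePlane]

theorem circlePlane_southPole (c : EuclideanSpace ℝ (Fin 2)) (r : ℝ) :
    circlePlane c r southPole = 1 := by
  simp only [circlePlane_apply, southPole, WithLp.equiv_symm_apply, Matrix.cons_val]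
  ring

theorem circlePlane_sphereLift (c : EuclideanSpace ℝ (Fin 2)) (r : ℝ)
    (x : EuclideanSpace ℝ (Fin 2)) :
    circlePlane c r (sphereLift x) = (dist c x ^ 2 - r ^ 2) / (x 0 ^ 2 + x 1 ^ 2 + 4) := by
  have h : x 0 ^ 2 + x 1 ^ 2 + 4 ≠ 0 := by positivity
  have h' : 4 + x 0 ^ 2 + x 1 ^ 2 ≠ 0 := by positivity
  rw [circlePlane_apply, EuclideanSpace.dist_sq_eq, Fin.sum_univ_two]
  simp only [sphereLift, WithLp.equiv_symm_apply, PiLp.toLp_apply, Matrix.cons_val,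
    Real.dist_eq, sq_abs]
  field_simp
  ring

/-- A point `q` lies strictly inside the circumcircle of three pairwise distinct
points `p₁, p₂, p₃` exactly when its lift to the unit sphere and the south pole lie
strictly on opposite sides of the plane through the three lifted points. -/
theorem inCircle_iff_sOppSide_lifted_plane
    (p₁ p₂ p₃ : EuclideanSpace ℝ (Fin 2))
    (h12 : p₁ ≠ p₂) (h13 : p₁ ≠ p₃) (h23 : p₂ ≠ p₃)
    (c : EuclideanSpace ℝ (Fin 2)) (r : ℝ)
    (hc₁ : dist c p₁ = r) (hc₂ : dist c p₂ = r) (hc₃ : dist c p₃ = r)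
    (q : EuclideanSpace ℝ (Fin 2)) :
    dist c q < r ↔
      (affineSpan ℝ ({sphereLift p₁, sphereLift p₂, sphereLift p₃} :
          Set (EuclideanSpace ℝ (Fin 3)))).SOppSide (sphereLift q) southPole := by
  have hi : AffineIndependent ℝ ![sphereLift p₁, sphereLift p₂, sphereLift p₃] := by
    refine EuclideanGeometry.Cospherical.affineIndependent_of_ne ⟨0, 1, ?_⟩
      (sphereLift_injective.ne h12) (sphereLift_injective.ne h13) (sphereLift_injective.ne h23)
    rintro x (rfl | rfl | rfl) <;> rw [dist_zero_right, norm_sphereLift]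
  have hzero {p : EuclideanSpace ℝ (Fin 2)} (hp : dist c p = r) :
      circlePlane c r (sphereLift p) = 0 := by
    simp [circlePlane_sphereLift, hp]
  have hlin : (circlePlane c r).linear ≠ 0 := by
    intro h
    have := (circlePlane c r).linearMap_vsub southPole (sphereLift p₁)
    rw [h, circlePlane_southPole, hzero hc₁] at this
    simp at this
  have hr : 0 ≤ r := hc₁ ▸ dist_nonneg
  rw [AffineSubspace.sOppSide_iff_mul_neg_of_mem_iff
      (mem_affineSpan_triple_iff_of_finrank_eq_three (by simp) hi hlin
        (hzero hc₁) (hzero hc₂) (hzero hc₃)),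
    circlePlane_southPole, mul_one, circlePlane_sphereLift, div_lt_iff₀ (by positivity),
    zero_mul, sub_neg, sq_lt_sq₀ dist_nonneg hr]
end

section
/- Let p₁, p₂, p₃ ∈ ℝ² be pairwise distinct points admitting a circumcenter–circumradius pair (c, r) (so dist c pᵢ = r for i = 1, 2, 3), and let q ∈ ℝ². Then dist c q = r if and only if L q ∈ affineSpan ℝ {L p₁, L p₂, L p₃}: the four points p₁, p₂, p₃, q are cocircular exactly when their lifts to the unit sphere are coplanar. -/
theorem sphereLift_apply_zero (x : EuclideanSpace ℝ (Fin 2)) :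
    sphereLift x 0 = 4 * x 0 / (x 0 ^ 2 + x 1 ^ 2 + 4) := rfl

theorem sphereLift_apply_one (x : EuclideanSpace ℝ (Fin 2)) :
    sphereLift x 1 = 4 * x 1 / (x 0 ^ 2 + x 1 ^ 2 + 4) := rfl

theorem sphereLift_apply_two (x : EuclideanSpace ℝ (Fin 2)) :
    sphereLift x 2 = 8 / (x 0 ^ 2 + x 1 ^ 2 + 4) - 1 := by
  have h : x 0 ^ 2 + x 1 ^ 2 + 4 ≠ 0 := by positivity
  change (4 - x 0 ^ 2 - x 1 ^ 2) / (4 + x 0 ^ 2 + x 1 ^ 2) = _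
  rw [show 4 + x 0 ^ 2 + x 1 ^ 2 = x 0 ^ 2 + x 1 ^ 2 + 4 by ring]
  field_simp
  ring

theorem dist_eq_iff_coords (c x : EuclideanSpace ℝ (Fin 2)) {r : ℝ} (hr : 0 ≤ r) :
    dist c x = r ↔ (c 0 - x 0) ^ 2 + (c 1 - x 1) ^ 2 = r ^ 2 := by
  rw [EuclideanSpace.dist_eq, Fin.sum_univ_two, Real.dist_eq, Real.dist_eq, sq_abs, sq_abs,
    Real.sqrt_eq_iff_eq_sq (by positivity) hr]

/-- A circle in the plane is the preimage under `sphereLift` of an affine plane. -/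
theorem dist_eq_iff_sphereLift (c x : EuclideanSpace ℝ (Fin 2)) {r : ℝ} (hr : 0 ≤ r) :
    dist c x = r ↔
      4 * c 0 * sphereLift x 0 + 4 * c 1 * sphereLift x 1
        - (c 0 ^ 2 + c 1 ^ 2 - r ^ 2 - 4) * (sphereLift x 2 + 1) = 8 := by
  have h : x 0 ^ 2 + x 1 ^ 2 + 4 ≠ 0 := by positivity
  rw [dist_eq_iff_coords c x hr, sphereLift_apply_zero, sphereLift_apply_one,
    sphereLift_apply_two]
  field_simp
  constructor <;> intro h <;> linarith

theorem ne_iff_sum_sq_sub_ne_zero (x y : EuclideanSpace ℝ (Fin 2)) :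
    x ≠ y ↔ (y 0 - x 0) ^ 2 + (y 1 - x 1) ^ 2 ≠ 0 := by
  refine not_congr ⟨fun h => by simp [h], fun h => ?_⟩
  ext i
  fin_cases i
  · change x 0 = y 0
    nlinarith [sq_nonneg (y 0 - x 0), sq_nonneg (y 1 - x 1)]
  · change x 1 = y 1
    nlinarith [sq_nonneg (y 0 - x 0), sq_nonneg (y 1 - x 1)]

/-- Two distinct nonzero vectors `u`, `v` lying on a circle through the origin with center `m`
are linearly independent. -/
theorem cross_ne_zero_of_cocircular {u₀ u₁ v₀ v₁ m₀ m₁ : ℝ}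
    (hu : u₀ ^ 2 + u₁ ^ 2 ≠ 0) (hv : v₀ ^ 2 + v₁ ^ 2 ≠ 0)
    (huv : (v₀ - u₀) ^ 2 + (v₁ - u₁) ^ 2 ≠ 0)
    (hmu : u₀ ^ 2 + u₁ ^ 2 = 2 * (m₀ * u₀ + m₁ * u₁))
    (hmv : v₀ ^ 2 + v₁ ^ 2 = 2 * (m₀ * v₀ + m₁ * v₁)) :
    u₀ * v₁ - u₁ * v₀ ≠ 0 := by
  intro h
  have h₁ : u₀ * v₀ + u₁ * v₁ = u₀ ^ 2 + u₁ ^ 2 := by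
    apply mul_left_cancel₀ hv
    linear_combination (u₀ * v₀ + u₁ * v₁) * hmv - (v₀ ^ 2 + v₁ ^ 2) * hmu
      + 2 * (m₁ * v₀ - m₀ * v₁) * h
  have h₂ : u₀ * v₀ + u₁ * v₁ = v₀ ^ 2 + v₁ ^ 2 := by
    apply mul_left_cancel₀ hu
    linear_combination (u₀ * v₀ + u₁ * v₁) * hmu - (u₀ ^ 2 + u₁ ^ 2) * hmv
      + 2 * (m₀ * u₁ - m₁ * u₀) * h
  exact huv (by linear_combination -h₁ - h₂)

/-- If `q` and its squared norm are the same affine combination of the `pᵢ` and of their squared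
norms, then the lift of `q` lies in the affine span of the lifts of the `pᵢ`. -/
theorem sphereLift_mem_affineSpan {p₁ p₂ p₃ q : EuclideanSpace ℝ (Fin 2)} {a b : ℝ}
    (h₀ : q 0 = p₁ 0 + a * (p₂ 0 - p₁ 0) + b * (p₃ 0 - p₁ 0))
    (h₁ : q 1 = p₁ 1 + a * (p₂ 1 - p₁ 1) + b * (p₃ 1 - p₁ 1))
    (hn : q 0 ^ 2 + q 1 ^ 2 = (1 - a - b) * (p₁ 0 ^ 2 + p₁ 1 ^ 2)
      + a * (p₂ 0 ^ 2 + p₂ 1 ^ 2) + b * (p₃ 0 ^ 2 + p₃ 1 ^ 2)) :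
    sphereLift q ∈ affineSpan ℝ ({sphereLift p₁, sphereLift p₂, sphereLift p₃} :
      Set (EuclideanSpace ℝ (Fin 3))) := by
  set w : EuclideanSpace ℝ (Fin 2) → ℝ := fun x => x 0 ^ 2 + x 1 ^ 2 + 4 with hw
  have hpos (x) : w x ≠ 0 := by simp only [hw]; positivity
  have hwq : w q = (1 - a - b) * w p₁ + a * w p₂ + b * w p₃ := by
    simp only [hw]
    linear_combination hn
  have e0 (x) : sphereLift x 0 = 4 * x 0 / w x := sphereLift_apply_zero x
  have e1 (x) : sphereLift x 1 = 4 * x 1 / w x := sphereLift_apply_one x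
  have e2 (x) : sphereLift x 2 = 8 / w x - 1 := sphereLift_apply_two x
  have m₁ := mem_affineSpan ℝ (show sphereLift p₁ ∈
    ({sphereLift p₁, sphereLift p₂, sphereLift p₃} : Set _) by simp)
  have m₂ := mem_affineSpan ℝ (show sphereLift p₂ ∈
    ({sphereLift p₁, sphereLift p₂, sphereLift p₃} : Set _) by simp)
  have m₃ := mem_affineSpan ℝ (show sphereLift p₃ ∈
    ({sphereLift p₁, sphereLift p₂, sphereLift p₃} : Set _) by simp)
  have key := AffineSubspace.smul_vsub_vadd_mem _ (b * w p₃ / w q) m₃ m₁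
    (AffineSubspace.smul_vsub_vadd_mem _ (a * w p₂ / w q) m₂ m₁ m₁)
  have hq := hpos q
  have hp₁ := hpos p₁
  have hp₂ := hpos p₂
  have hp₃ := hpos p₃
  clear_value w
  convert key using 1
  ext i
  fin_cases i
  · simp [e0]
    field_simp
    linear_combination w p₁ * h₀ - p₁ 0 * hwq
  · simp [e1]
    field_simp
    linear_combination w p₁ * h₁ - p₁ 1 * hwq
  · simp [e2]
    field_simp
    linear_combination -8 * hwq

/-- Four points `p₁, p₂, p₃, q` of the plane are cocircular exactly when their lifts
to the unit sphere are coplanar. -/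
theorem cocircular_iff_lifts_coplanar
    (p₁ p₂ p₃ : EuclideanSpace ℝ (Fin 2))
    (h12 : p₁ ≠ p₂) (h13 : p₁ ≠ p₃) (h23 : p₂ ≠ p₃)
    (c : EuclideanSpace ℝ (Fin 2)) (r : ℝ)
    (hc₁ : dist c p₁ = r) (hc₂ : dist c p₂ = r) (hc₃ : dist c p₃ = r)
    (q : EuclideanSpace ℝ (Fin 2)) :
    dist c q = r ↔
      sphereLift q ∈ affineSpan ℝ ({sphereLift p₁, sphereLift p₂, sphereLift p₃} :
        Set (EuclideanSpace ℝ (Fin 3))) := by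
  have hr : 0 ≤ r := hc₁ ▸ dist_nonneg
  constructor
  · intro hq
    rw [dist_eq_iff_coords _ _ hr] at hc₁ hc₂ hc₃ hq
    rw [ne_iff_sum_sq_sub_ne_zero] at h12 h13 h23
    have hD : (p₂ 0 - p₁ 0) * (p₃ 1 - p₁ 1) - (p₂ 1 - p₁ 1) * (p₃ 0 - p₁ 0) ≠ 0 :=
      cross_ne_zero_of_cocircular (m₀ := c 0 - p₁ 0) (m₁ := c 1 - p₁ 1) h12 h13
        (by simpa using h23)
        (by linear_combination hc₂ - hc₁) (by linear_combination hc₃ - hc₁)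
    obtain ⟨a, ha⟩ : ∃ a, a = ((q 0 - p₁ 0) * (p₃ 1 - p₁ 1) - (q 1 - p₁ 1) * (p₃ 0 - p₁ 0)) /
      ((p₂ 0 - p₁ 0) * (p₃ 1 - p₁ 1) - (p₂ 1 - p₁ 1) * (p₃ 0 - p₁ 0)) := ⟨_, rfl⟩
    obtain ⟨b, hb⟩ : ∃ b, b = ((p₂ 0 - p₁ 0) * (q 1 - p₁ 1) - (p₂ 1 - p₁ 1) * (q 0 - p₁ 0)) /
      ((p₂ 0 - p₁ 0) * (p₃ 1 - p₁ 1) - (p₂ 1 - p₁ 1) * (p₃ 0 - p₁ 0)) := ⟨_, rfl⟩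
    rw [eq_div_iff hD] at ha hb
    have h₀ : q 0 = p₁ 0 + a * (p₂ 0 - p₁ 0) + b * (p₃ 0 - p₁ 0) := by
      apply mul_left_cancel₀ hD
      linear_combination -(p₂ 0 - p₁ 0) * ha - (p₃ 0 - p₁ 0) * hb
    have h₁ : q 1 = p₁ 1 + a * (p₂ 1 - p₁ 1) + b * (p₃ 1 - p₁ 1) := by
      apply mul_left_cancel₀ hD
      linear_combination -(p₂ 1 - p₁ 1) * ha - (p₃ 1 - p₁ 1) * hb
    refine sphereLift_mem_affineSpan h₀ h₁ ?_
    linear_combination hq - (1 - a - b) * hc₁ - a * hc₂ - b * hc₃ + 2 * c 0 * h₀ + 2 * c 1 * h₁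
  · intro hq
    rw [dist_eq_iff_sphereLift _ _ hr] at hc₁ hc₂ hc₃ ⊢
    refine affineSpan_induction
      (p := fun y => 4 * c 0 * y 0 + 4 * c 1 * y 1
        - (c 0 ^ 2 + c 1 ^ 2 - r ^ 2 - 4) * (y 2 + 1) = 8) hq ?_ ?_
    · rintro x (rfl | rfl | rfl) <;> assumption
    · intro t u v w hu hv hw
      simp only [vsub_eq_sub, vadd_eq_add, PiLp.add_apply, PiLp.smul_apply, PiLp.sub_apply,
        smul_eq_mul]
      linear_combination t * hu - t * hv + hw
end

section
/- In the hyperbolic plane ℍ, for every real number a > 0 and every real number r there exists a point z : ℍ such that the closed hyperbolic ball Metric.closedBall z r is contained in the region {w : ℍ | a · w.im < w.re} bounded by the hypercycle {w | w.re = a · w.im}. (Any region of the hyperbolic plane bounded by a hypercycle contains hyperbolic disks of arbitrarily large radius; together with the horoball case this shows that non-compact 'disks' bounded by non-compact circles contain disks of any diameter.) -/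
open UpperHalfPlane

/-- Any region of the hyperbolic plane bounded by a hypercycle contains hyperbolic
disks of arbitrarily large radius: for every `a > 0` and every `r` there is a point
`z` of the upper half-plane whose closed hyperbolic ball of radius `r` is contained
in the region `{w | a * w.im < w.re}` bounded by the hypercycle
`{w | w.re = a * w.im}`. -/
theorem hypercycle_region_contains_arbitrarily_large_balls
    (a : ℝ) (ha : 0 < a) (r : ℝ) :
    ∃ z : UpperHalfPlane,
      Metric.closedBall z r ⊆ {w : UpperHalfPlane | a * w.im < w.re} := by
  refine ⟨⟨⟨(a + 1) * Real.exp r, 1⟩, one_pos⟩, fun w hw => ?_⟩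
  set z : ℍ := ⟨⟨(a + 1) * Real.exp r, 1⟩, one_pos⟩
  have hexp : Real.exp (dist w z) ≤ Real.exp r := Real.exp_le_exp.2 hw
  have him : w.im ≤ 1 * Real.exp (dist w z) := im_le_im_mul_exp_dist w z
  have hdist : dist (w : ℂ) z ≤ 1 * (Real.exp (dist w z) - 1) := dist_coe_le w z
  have hre : |w.re - (a + 1) * Real.exp r| ≤ dist (w : ℂ) z := by
    rw [Complex.dist_eq]
    exact Complex.abs_re_le_norm ((w : ℂ) - z)
  have hmul : a * w.im ≤ a * Real.exp r := by gcongr; linarith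
  change a * w.im < w.re
  linarith [neg_abs_le (w.re - (a + 1) * Real.exp r)]
end
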